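/- arXiv:2303.14000 — 3 statements merged into one kernel-verified Lean document; each statement's English description precedes it below -/
import Mathlib

section
/- Let p > 3 be a prime with p ≡ 3 (mod 4), and let K = ℚ(√−p), an imaginary quadratic field of discriminant −p with class number h_K. Then h_K² = Σ_{b=1}^{p−1} (b/p) · s(b,p), where (b/p) is the Legendre symbol. -/
open Finset Real NumberField

/-- The Dedekind sum `s(c,d) = (1/(4d)) ∑_{n=1}^{d-1} cot(πn/d) cot(πnc/d)`. -/
noncomputable def dedekindSum (c : ℤ) (d : ℕ) : ℝ :=
  (1 / (4 * (d : ℝ))) *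
    ∑ n ∈ Finset.Ioo 0 d, Real.cot (Real.pi * n / d) * Real.cot (Real.pi * n * c / d)

section analytic
open Filter Topology HurwitzZeta

lemma rpow_diff_bound {x y s : ℝ} (hx : 0 < x) (hxy : x ≤ y) (hyx : y ≤ x + 1) (h1 : 1 ≤ s) (h2 : s ≤ 2) :
    |1 / x ^ s - 1 / y ^ s| ≤ (1 / x + 1 / x ^ 2) * (2 / x) := by
  have hy : 0 < y := hx.trans_le hxy
  have hxs : 0 < x ^ s := rpow_pos_of_pos hx s
  have hys : 0 < y ^ s := rpow_pos_of_pos hy s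
  have hle : x ^ s ≤ y ^ s := rpow_le_rpow hx.le hxy (by linarith)
  have e : 1 / x ^ s - 1 / y ^ s = (1 / x ^ s) * (1 - (x / y) ^ s) := by
    rw [div_rpow hx.le hy.le]; field_simp
  have hq0 : 0 < x / y := by positivity
  have hq1 : x / y ≤ 1 := (div_le_one hy).2 hxy
  have hq2 : (x / y) ^ s ≤ 1 := rpow_le_one hq0.le hq1 (by linarith)
  have hq3 : (x / y) ^ (2:ℝ) ≤ (x / y) ^ s := rpow_le_rpow_of_exponent_ge hq0 hq1 h2
  rw [e, abs_of_nonneg (mul_nonneg (by positivity) (by linarith))]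
  refine mul_le_mul ?_ ?_ (by linarith) (by positivity)
  · rcases le_total x 1 with hx1 | hx1
    · have : x ^ (2:ℝ) ≤ x ^ s := rpow_le_rpow_of_exponent_ge hx hx1 h2
      rw [rpow_two] at this
      have := one_div_le_one_div_of_le (by positivity) this
      have : 0 < 1 / x := by positivity
      linarith
    · have : x ^ (1:ℝ) ≤ x ^ s := rpow_le_rpow_of_exponent_le hx1 h1
      rw [rpow_one] at this
      have := one_div_le_one_div_of_le (by positivity) this
      have : 0 < 1 / x ^ 2 := by positivity
      linarith
  · rw [rpow_two] at hq3
    have h3 : 1 - (x / y) ^ 2 ≤ 2 * (1 - x / y) := by nlinarith [sq_nonneg (1 - x / y)]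
    have h4 : 1 - x / y = (y - x) / y := by field_simp
    have h5 : (y - x) / y ≤ 1 / x := by
      rw [div_le_div_iff₀ hy hx]; nlinarith
    have : 2 / x = 2 * (1 / x) := by ring
    linarith

lemma hurwitz_term_bound {a s : ℝ} (h0 : 0 < a) (h1 : a < 1) (hs1 : 1 ≤ s) (hs2 : s ≤ 2) (n : ℕ) :
    |(1 / (n + a) ^ s - 1 / (n + 1 - a) ^ s) / 2| ≤
      (1 / (min a (1 - a)) + 1 / (min a (1 - a)) ^ 2) * (2 / (min a (1 - a))) *
        (1 / ((n : ℝ) + 1) ^ 2) := by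
  set δ := min a (1 - a) with hδ
  have hδ0 : 0 < δ := lt_min h0 (by linarith)
  have hδa : δ ≤ a := min_le_left _ _
  have hδb : δ ≤ 1 - a := min_le_right _ _
  have hn : (0:ℝ) ≤ n := n.cast_nonneg
  have key : ∀ x y : ℝ, δ * (n + 1) ≤ x → x ≤ y → y ≤ x + 1 →
      |1 / x ^ s - 1 / y ^ s| ≤ (1 / δ + 1 / δ ^ 2) * (2 / δ) * (1 / ((n : ℝ) + 1) ^ 2) := by
    intro x y hx hxy hyx
    have hd : 0 < δ * (n + 1) := by positivity
    have hx0 : 0 < x := hd.trans_le hx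
    refine (rpow_diff_bound hx0 hxy hyx hs1 hs2).trans ?_
    have i1 : 1 / x ≤ 1 / δ * (1 / (n + 1)) := by
      exact (one_div_le_one_div_of_le hd hx).trans (by rw [one_div_mul_one_div])
    have i2 : 1 / x ^ 2 ≤ 1 / δ ^ 2 * (1 / (n + 1)) := by
      have : 1 / x ^ 2 ≤ (1 / δ * (1 / (n + 1))) ^ 2 := by
        rw [← one_div_pow]; exact pow_le_pow_left₀ (by positivity) i1 2
      refine this.trans ?_
      have h : 1 / ((n:ℝ) + 1) ≤ 1 := by rw [div_le_one] <;> linarith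
      rw [mul_pow, one_div_pow]
      refine mul_le_mul_of_nonneg_left ?_ (by positivity)
      have : 0 ≤ 1 / ((n:ℝ) + 1) := by positivity
      nlinarith
    calc _ ≤ (1 / δ * (1 / (n + 1)) + 1 / δ ^ 2 * (1 / (n + 1))) * (2 * (1 / δ * (1 / (n + 1)))) := by
          refine mul_le_mul (add_le_add i1 i2) ?_ (by positivity) (by positivity)
          have : 2 / x = 2 * (1 / x) := by ring
          linarith
      _ = _ := by field_simp
  have hh : |1 / (n + a) ^ s - 1 / (n + 1 - a) ^ s| ≤
      (1 / δ + 1 / δ ^ 2) * (2 / δ) * (1 / ((n : ℝ) + 1) ^ 2) := by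
    rcases le_total ((n:ℝ) + a) (n + 1 - a) with h | h
    · exact key _ _ (by nlinarith) h (by linarith)
    · rw [abs_sub_comm]
      exact key _ _ (by nlinarith) h (by linarith)
  rw [abs_div, abs_two]
  have := abs_nonneg (1 / ((n:ℝ) + a) ^ s - 1 / (n + 1 - a) ^ s)
  linarith

lemma cot_hasSum {a : ℝ} (h0 : 0 < a) (h1 : a < 1) :
    ∑' n : ℕ, (1 / ((n:ℝ) + a) ^ (1:ℝ) - 1 / (n + 1 - a) ^ (1:ℝ)) / 2 = π / 2 * Real.cot (π * a) := by
  have hsum : Summable fun n : ℕ => (1 / ((n:ℝ) + a) ^ (1:ℝ) - 1 / (n + 1 - a) ^ (1:ℝ)) / 2 := by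
    refine Summable.of_norm_bounded ?_ (fun n => hurwitz_term_bound h0 h1 le_rfl one_le_two n)
    refine Summable.mul_left _ ?_
    have := (summable_nat_add_iff 1).2 (Real.summable_one_div_nat_pow.2 (one_lt_two))
    simpa using this
  refine tendsto_nhds_unique hsum.hasSum.tendsto_sum_nat ?_
  have hz : (a : ℂ) ∈ Complex.integerComplement := by
    rintro ⟨k, hk⟩
    have hk' : (k : ℝ) = a := by exact_mod_cast hk
    have a1 : (0:ℝ) < k := by linarith
    have a2 : (k:ℝ) < 1 := by linarith
    norm_cast at a1 a2
    omega
  have hc := tendsto_logDeriv_euler_cot_sub hz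
  have hc' : Tendsto (fun n : ℕ => ∑ j ∈ Finset.range n, (1 / (a - (j + 1)) + 1 / (a + (j + 1)))) atTop
      (𝓝 (π * Real.cot (π * a) - 1 / a)) := by
    have h := (Complex.continuous_re.tendsto _).comp hc
    refine (h.congr fun n => ?_).trans_eq ?_
    · have : ∑ j ∈ Finset.range n, cotTerm (a : ℂ) j =
          ((∑ j ∈ Finset.range n, (1 / (a - (j + 1)) + 1 / (a + (j + 1))) : ℝ) : ℂ) := by
        push_cast
        simp [cotTerm]
      simp only [Function.comp_apply, this, Complex.ofReal_re]
    · have : (π : ℂ) * Complex.cot (π * a) - 1 / a = ((π * Real.cot (π * a) - 1 / a : ℝ) : ℂ) := by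
        push_cast; rfl
      rw [this, Complex.ofReal_re]
  have ht : Tendsto (fun n : ℕ => 1 / (a + n)) atTop (𝓝 0) := by
    simp only [one_div]
    exact tendsto_inv_atTop_zero.comp (tendsto_atTop_add_const_left _ _ tendsto_natCast_atTop_atTop)
  have := ((hc'.const_add (1 / a)).sub ht).div_const 2
  refine (this.congr ?_).trans_eq ?_
  · intro N
    rw [← Finset.sum_div]
    congr 1
    induction N with
    | zero => simp
    | succ N ih =>
      rw [Finset.sum_range_succ, Finset.sum_range_succ, ← ih, rpow_one, rpow_one]
      have e : 1 / (a - ((N:ℝ) + 1)) = - (1 / (N + 1 - a)) := by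
        rw [← neg_sub, one_div, one_div, inv_neg]
      push_cast
      rw [e, add_comm (N:ℝ) a]
      ring
  · congr 1; ring

lemma hurwitzZetaOdd_one {a : ℝ} (h0 : 0 < a) (h1 : a < 1) :
    hurwitzZetaOdd a 1 = ((π / 2 * Real.cot (π * a) : ℝ) : ℂ) := by
  have hc : Tendsto (fun s : ℝ => hurwitzZetaOdd a (s:ℂ)) (𝓝[>] 1) (𝓝 (hurwitzZetaOdd a 1)) := by
    have : Continuous fun s : ℝ => hurwitzZetaOdd a (s:ℂ) :=
      (differentiable_hurwitzZetaOdd a).continuous.comp Complex.continuous_ofReal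
    have := (this.tendsto 1).mono_left (nhdsWithin_le_nhds (s := Set.Ioi (1:ℝ)))
    simpa using this
  refine tendsto_nhds_unique hc ?_
  rw [← cot_hasSum h0 h1]
  have heq : ∀ s : ℝ, 1 < s → hurwitzZetaOdd a (s:ℂ) =
      ((∑' n : ℕ, (1 / ((n:ℝ) + a) ^ s - 1 / (n + 1 - a) ^ s) / 2 : ℝ) : ℂ) := by
    intro s hs
    rw [← (hasSum_nat_hurwitzZetaOdd_of_mem_Icc ⟨h0.le, h1.le⟩ (s := s) (by simpa using hs)).tsum_eq,
      Complex.ofReal_tsum]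
    congr 1
    ext n
    have hn : (0:ℝ) ≤ n := n.cast_nonneg
    rw [Complex.ofReal_div, Complex.ofReal_sub, Complex.ofReal_div, Complex.ofReal_div,
      Complex.ofReal_cpow (by linarith), Complex.ofReal_cpow (by linarith)]
    push_cast
    rfl
  have hr : Tendsto (fun s : ℝ => ∑' n : ℕ, (1 / ((n:ℝ) + a) ^ s - 1 / (n + 1 - a) ^ s) / 2) (𝓝[>] 1)
      (𝓝 (∑' n : ℕ, (1 / ((n:ℝ) + a) ^ (1:ℝ) - 1 / (n + 1 - a) ^ (1:ℝ)) / 2)) := by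
    refine tendsto_tsum_of_dominated_convergence (bound := fun n : ℕ =>
      (1 / (min a (1 - a)) + 1 / (min a (1 - a)) ^ 2) * (2 / (min a (1 - a))) *
        (1 / ((n : ℝ) + 1) ^ 2)) ?_ ?_ ?_
    · refine Summable.mul_left _ ?_
      have := (summable_nat_add_iff 1).2 (Real.summable_one_div_nat_pow.2 (one_lt_two))
      simpa using this
    · intro n
      refine Tendsto.mono_left ?_ nhdsWithin_le_nhds
      have hn : (0:ℝ) ≤ n := n.cast_nonneg
      have c1 : ContinuousAt (fun s : ℝ => ((n:ℝ) + a) ^ s) 1 :=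
        Real.continuousAt_const_rpow (by linarith)
      have c2 : ContinuousAt (fun s : ℝ => ((n:ℝ) + 1 - a) ^ s) 1 :=
        Real.continuousAt_const_rpow (by linarith)
      exact (((continuousAt_const.div c1 (rpow_pos_of_pos (by linarith) _).ne').sub
        (continuousAt_const.div c2 (rpow_pos_of_pos (by linarith) _).ne')).div_const 2).tendsto
    · filter_upwards [Ioc_mem_nhdsGT (one_lt_two)] with s hs n
      exact hurwitz_term_bound h0 h1 hs.1.le hs.2 n
  refine ((Complex.continuous_ofReal.tendsto _).comp hr).congr' ?_
  filter_upwards [self_mem_nhdsWithin] with s hs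
  exact (heq s hs).symm

lemma sum_zmod_eq {M : Type*} [AddCommMonoid M] (p : ℕ) [NeZero p] (f : ZMod p → M) (h0 : f 0 = 0) :
    ∑ j : ZMod p, f j = ∑ n ∈ Finset.Ioo 0 p, f n := by
  rw [← Finset.sum_erase (Finset.univ) h0]
  symm
  refine Finset.sum_bij' (fun n _ => (n : ZMod p)) (fun j _ => j.val) ?_ ?_ ?_ ?_ ?_
  · intro n hn
    simp only [Finset.mem_Ioo] at hn
    simp only [Finset.mem_erase, Finset.mem_univ, and_true, ne_eq, ZMod.natCast_eq_zero_iff]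
    exact Nat.not_dvd_of_pos_of_lt hn.1 hn.2
  · intro j hj
    simp only [Finset.mem_erase, Finset.mem_univ, and_true] at hj
    simp only [Finset.mem_Ioo]
    exact ⟨Nat.pos_of_ne_zero ((ZMod.val_ne_zero j).2 hj), ZMod.val_lt j⟩
  · intro n hn
    simp only [Finset.mem_Ioo] at hn
    exact ZMod.val_cast_of_lt hn.2
  · intro j hj
    simp
  · intro n hn
    rfl

/-- The Legendre symbol as a complex Dirichlet character. -/
noncomputable def legChar (p : ℕ) [Fact p.Prime] : DirichletCharacter ℂ p :=
  (quadraticChar (ZMod p)).ringHomComp (Int.castRingHom ℂ)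

lemma legChar_apply (p : ℕ) [Fact p.Prime] (n : ZMod p) :
    legChar p n = ((quadraticChar (ZMod p) n : ℤ) : ℂ) := rfl

lemma quadChar_neg (p : ℕ) [Fact p.Prime] (hp4 : p % 4 = 3) (n : ZMod p) :
    quadraticChar (ZMod p) (-n) = - quadraticChar (ZMod p) n := by
  have : quadraticChar (ZMod p) (-1) = -1 := by
    have := legendreSym.at_neg_one (p := p) (by omega)
    rw [ZMod.χ₄_nat_three_mod_four hp4] at this
    simpa [legendreSym] using this
  rw [← neg_one_mul, map_mul, this, neg_one_mul]

lemma legChar_ne_one (p : ℕ) [Fact p.Prime] (hp4 : p % 4 = 3) : legChar p ≠ 1 := by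
  intro h
  have h1 := legChar_apply p (-1)
  rw [h, quadChar_neg p hp4 1] at h1
  rw [MulChar.one_apply (isUnit_one.neg), map_one] at h1
  norm_num at h1

/-- The character sum of cotangents. -/
noncomputable def cotSum (p : ℕ) [Fact p.Prime] : ℝ :=
  ∑ n ∈ Finset.Ioo 0 p, (legendreSym p n : ℝ) * Real.cot (π * n / p)

lemma LFunction_legChar_one (p : ℕ) [Fact p.Prime] (hp4 : p % 4 = 3) :
    (legChar p).LFunction 1 = ((π / (2 * p) * cotSum p : ℝ) : ℂ) := by
  have hodd : Function.Odd (legChar p) := by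
    intro n
    rw [legChar_apply, quadChar_neg p hp4, legChar_apply]; push_cast; rfl
  have hp0 : (0:ℝ) < p := by exact_mod_cast (Fact.out : p.Prime).pos
  rw [DirichletCharacter.LFunction, ZMod.LFunction_def_odd hodd, sum_zmod_eq p _ (by rw [legChar_apply]; simp), cotSum,
    Complex.cpow_neg_one, Finset.mul_sum, Finset.mul_sum, Complex.ofReal_sum]
  refine Finset.sum_congr rfl fun n hn => ?_
  simp only [Finset.mem_Ioo] at hn
  rw [ZMod.toAddCircle_apply, ZMod.val_cast_of_lt hn.2, hurwitzZetaOdd_one, legChar_apply]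
  · simp only [legendreSym]
    push_cast
    rw [mul_div_assoc]
    field_simp
  · have : (0:ℝ) < n := by exact_mod_cast hn.1
    positivity
  · rw [div_lt_one hp0]; exact_mod_cast hn.2

lemma real_cot_add_int_mul_pi (x : ℝ) (k : ℤ) : Real.cot (x + k * π) = Real.cot x := by
  rw [Real.cot_eq_cos_div_sin, Real.cot_eq_cos_div_sin, Real.cos_add_int_mul_pi,
    Real.sin_add_int_mul_pi, mul_div_mul_left]
  exact zpow_ne_zero _ (by norm_num)

lemma cot_zmod (p : ℕ) [NeZero p] (m : ℤ) :
    Real.cot (π * m / p) = Real.cot (π * ((m : ZMod p).val : ℝ) / p) := by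
  have hp0 : (p:ℝ) ≠ 0 := by exact_mod_cast NeZero.ne p
  have h : (((m : ZMod p).val : ℕ) : ℤ) = m % p := ZMod.val_intCast m
  have h2 : (m : ℝ) = ((m : ZMod p).val : ℝ) + p * ((m / p : ℤ) : ℝ) := by
    have := Int.emod_add_mul_ediv m p
    rw [← h] at this
    exact_mod_cast this.symm
  rw [← real_cot_add_int_mul_pi (π * ((m : ZMod p).val : ℝ) / p) (m / p)]
  congr 1
  generalize ((m : ZMod p).val : ℝ) = v at h2 ⊢
  rw [h2]
  field_simp

lemma sum_legendre_dedekind (p : ℕ) [Fact p.Prime] :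
    ∑ b ∈ Finset.Ioo 0 p, (legendreSym p b : ℝ) * dedekindSum b p =
      1 / (4 * p) * (cotSum p) ^ 2 := by
  set c : ZMod p → ℝ := fun j => Real.cot (π * (j.val : ℝ) / p) with hc
  set q : ZMod p → ℝ := fun j => ((quadraticChar (ZMod p) j : ℤ) : ℝ) with hq
  have hq0 : q 0 = 0 := by simp [hq]
  have hcot0 : Real.cot 0 = 0 := by simp [Real.cot_eq_cos_div_sin]
  have hqm : ∀ a b, q (a * b) = q a * q b := by intro a b; simp only [hq, map_mul, Int.cast_mul]
  have hS : cotSum p = ∑ j : ZMod p, q j * c j := by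
    rw [sum_zmod_eq p _ (by simp [hq0]), cotSum]
    refine Finset.sum_congr rfl fun n hn => ?_
    have := cot_zmod p n
    simp only [Int.cast_natCast] at this
    simp only [hq, hc, this, legendreSym, Int.cast_natCast]
  have hD : ∀ b : ℕ, dedekindSum b p = 1 / (4 * p) * ∑ n : ZMod p, c n * c (n * b) := by
    intro b
    rw [dedekindSum, sum_zmod_eq p _ (by simp [hc, hcot0])]
    congr 1
    refine Finset.sum_congr rfl fun n hn => ?_
    have h1 := cot_zmod p n
    have h2 := cot_zmod p (n * b)
    push_cast at h1 h2
    simp only [hc, h1, ← mul_assoc] at h2 ⊢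
    rw [← h2]
    simp
  calc _ = ∑ b : ZMod p, q b * (1 / (4 * p) * ∑ n : ZMod p, c n * c (n * b)) := by
        rw [sum_zmod_eq p _ (by simp [hq0])]
        refine Finset.sum_congr rfl fun b hb => ?_
        rw [hD]; simp only [hq, legendreSym, Int.cast_natCast]
    _ = 1 / (4 * p) * ∑ n : ZMod p, ∑ b : ZMod p, q b * (c n * c (n * b)) := by
        rw [Finset.sum_comm, Finset.mul_sum]
        refine Finset.sum_congr rfl fun b hb => ?_
        rw [Finset.mul_sum, Finset.mul_sum, Finset.mul_sum]
        refine Finset.sum_congr rfl fun n hn => ?_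
        ring
    _ = 1 / (4 * p) * ∑ n : ZMod p, ∑ b : ZMod p, (q n * c n) * (q b * c b) := by
        congr 1
        refine Finset.sum_congr rfl fun n _ => ?_
        by_cases hn : n = 0
        · subst hn
          simp [hc, hcot0]
        · have hqn : q n * q n = 1 := by
            rw [← hqm, ← sq]; simp only [hq, map_pow, quadraticChar_sq_one hn]; simp
          rw [← Equiv.sum_comp (Equiv.mulLeft₀ n hn) (fun b => (q n * c n) * (q b * c b))]
          refine Finset.sum_congr rfl fun b _ => ?_
          change _ = (q n * c n) * (q (n * b) * c (n * b))
          rw [hqm]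
          linear_combination (- q b * c n * c (n * b)) * hqn
    _ = _ := by
        rw [hS, sq, Finset.sum_mul_sum]

end analytic

lemma rat_sq_mul_prime_int {p : ℕ} (hp : p.Prime) (w : ℚ) (T : ℤ) (h : (p : ℚ) * w ^ 2 = T) :
    ∃ B : ℤ, w = B := by
  have hd : (w.den : ℚ) ≠ 0 := by exact_mod_cast w.den_nz
  have h1 : (p : ℤ) * w.num ^ 2 = T * (w.den : ℤ) ^ 2 := by
    have : (p : ℚ) * (w.num : ℚ) ^ 2 = T * (w.den : ℚ) ^ 2 := by
      rw [← h]
      nth_rewrite 2 [← Rat.num_div_den w]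
      field_simp
    exact_mod_cast this
  have hcop : IsCoprime ((w.den : ℤ) ^ 2) (w.num ^ 2) := by
    refine IsCoprime.pow ?_
    rw [isCoprime_comm]
    exact Int.isCoprime_iff_gcd_eq_one.2 (by simpa [Int.gcd] using w.reduced)
  have hdvd : ((w.den : ℤ) ^ 2) ∣ (p : ℤ) := hcop.dvd_of_dvd_mul_right ⟨T, by rw [h1]; ring⟩
  have hdvd' : w.den * w.den ∣ p := by
    rw [← sq]; exact_mod_cast hdvd
  have h1 : w.den = 1 := Nat.isUnit_iff.1 (hp.prime.squarefree _ hdvd')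
  exact ⟨w.num, by rw [← Rat.num_div_den w, h1]; simp⟩

/-- Structure of the ring of integers. -/
lemma exists_integral_basis (p : ℕ) (hp : p.Prime) (hp4 : p % 4 = 3)
    (K : Type*) [Field K] [NumberField K]
    (α : K) (hα : α ^ 2 = -(p : K)) (hquad : Module.finrank ℚ K = 2) :
    ∃ (c : ℤ) (ω : 𝓞 K) (b : Module.Basis (Fin 2) ℤ (𝓞 K)), 4 * c = p + 1 ∧
      ω ^ 2 = ω - c ∧ b 0 = 1 ∧ b 1 = ω := by
  have hli : ∀ s t : ℚ, (s : K) + (t : K) * α = 0 → s = 0 ∧ t = 0 := by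
    intro s t h
    have h2 : ((s ^ 2 + p * t ^ 2 : ℚ) : K) = 0 := by
      push_cast
      linear_combination ((s : K) - t * α) * h + (t : K) ^ 2 * hα
    have h3 : s ^ 2 + p * t ^ 2 = 0 := by exact_mod_cast h2
    have hp0 : (0 : ℚ) < p := by exact_mod_cast hp.pos
    have hs : s ^ 2 = 0 := by nlinarith [sq_nonneg s, mul_nonneg hp0.le (sq_nonneg t)]
    have ht : p * t ^ 2 = 0 := by linarith
    refine ⟨by simpa using hs, ?_⟩
    simpa [hp0.ne'] using ht
  have hlin : LinearIndependent ℚ ![(1 : K), α] := by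
    rw [LinearIndependent.pair_iff]
    intro s t h
    refine hli s t ?_
    simpa [Algebra.smul_def] using h
  let B := basisOfLinearIndependentOfCardEqFinrank hlin (by simp [hquad])
  have hB0 : B 0 = 1 := by simp [B]
  have hB1 : B 1 = α := by simp [B]
  have hcoord : ∀ x : K, ∃ u v : ℚ, x = u + v * α := by
    intro x
    refine ⟨B.repr x 0, B.repr x 1, ?_⟩
    have := B.sum_repr x
    rw [Fin.sum_univ_two, hB0, hB1] at this
    simpa [Algebra.smul_def] using this.symm
  have hrepr : ∀ u v : ℚ, B.repr (u + v * α) 0 = u ∧ B.repr (u + v * α) 1 = v := by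
    intro u v
    have : (u + v * α : K) = u • B 0 + v • B 1 := by
      rw [hB0, hB1]; simp [Algebra.smul_def]
    rw [this]
    simp
  have htr : ∀ u v : ℚ, Algebra.trace ℚ K (u + v * α) = 2 * u ∧
      Algebra.norm ℚ (u + v * α : K) = u ^ 2 + p * v ^ 2 := by
    intro u v
    have e : (u + v * α : K) * α = ((- (p * v) : ℚ) : K) + (u : K) * α := by
      push_cast; linear_combination (v : K) * hα
    rw [Algebra.trace_eq_matrix_trace B, Algebra.norm_eq_matrix_det B, Matrix.trace_fin_two,
      Matrix.det_fin_two]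
    simp only [Algebra.leftMulMatrix_eq_repr_mul, hB0, hB1, mul_one]
    rw [e]
    simp only [(hrepr _ _).1, (hrepr _ _).2]
    constructor <;> ring
  obtain ⟨c, hc⟩ : ∃ c : ℤ, 4 * c = p + 1 := ⟨((p + 1) / 4 : ℤ), by omega⟩
  have hcK : (4 : K) * c = p + 1 := by exact_mod_cast congrArg (Int.cast : ℤ → K) hc
  have hω0 : ((1 + α) / 2) ^ 2 = (1 + α) / 2 - (c : K) := by
    field_simp
    linear_combination hα + hcK
  have hωint : IsIntegral ℤ ((1 + α) / 2) := by
    refine ⟨Polynomial.X ^ 2 - Polynomial.X + Polynomial.C c, by monicity!, ?_⟩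
    rw [Polynomial.eval₂_add, Polynomial.eval₂_sub, Polynomial.eval₂_pow, Polynomial.eval₂_X,
      Polynomial.eval₂_C, hω0]
    simp
  let ω : 𝓞 K := ⟨(1 + α) / 2, hωint⟩
  have hωK : (ω : K) = (1 + α) / 2 := rfl
  have hω : ω ^ 2 = ω - c := by
    apply RingOfIntegers.ext
    have : (algebraMap (𝓞 K) K) ω = (1 + α) / 2 := rfl
    simpa [this] using hω0
  have hgen : ∀ x : 𝓞 K, ∃ m n : ℤ, x = m + n * ω := by
    intro x
    obtain ⟨u, v, huv⟩ := hcoord x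
    have hx : IsIntegral ℤ (x : K) := x.2
    obtain ⟨A, hA⟩ := IsIntegrallyClosed.isIntegral_iff.1 (Algebra.isIntegral_trace (L := ℚ) hx)
    obtain ⟨M, hM⟩ := IsIntegrallyClosed.isIntegral_iff.1 (Algebra.isIntegral_norm ℚ hx)
    rw [huv, (htr u v).1] at hA
    rw [huv, (htr u v).2] at hM
    simp only [algebraMap_int_eq, eq_intCast] at hA hM
    obtain ⟨n, hn⟩ := rat_sq_mul_prime_int hp (2 * v) (4 * M - A ^ 2) (by
      push_cast; rw [hA, hM]; ring)
    have hpar : A ^ 2 + p * n ^ 2 = 4 * M := by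
      have : (A : ℚ) ^ 2 + p * (n : ℚ) ^ 2 = 4 * M := by rw [hA, hM, ← hn]; ring
      exact_mod_cast this
    have hev : Even (A - n) := by
      have h4 : Even (A ^ 2 + p * n ^ 2) := ⟨2 * M, by rw [hpar]; ring⟩
      have hpo : ¬ Even (p : ℤ) := by
        rw [Int.even_iff]; omega
      simp only [Int.even_add, Int.even_mul, Int.even_pow, hpo, false_or, ne_eq,
        OfNat.ofNat_ne_zero, not_false_eq_true, and_true] at h4
      simpa [Int.even_sub] using h4
    obtain ⟨m, hm⟩ := hev
    refine ⟨m, n, ?_⟩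
    apply RingOfIntegers.ext
    have hA' : (A : K) = 2 * u := by exact_mod_cast congrArg (Rat.cast : ℚ → K) hA
    have hn' : (2 : K) * v = n := by exact_mod_cast congrArg (Rat.cast : ℚ → K) hn
    have hm' : (A : K) - n = m + m := by exact_mod_cast congrArg (Int.cast : ℤ → K) hm
    have : (algebraMap (𝓞 K) K) ω = (1 + α) / 2 := rfl
    have e : (algebraMap (𝓞 K) K) (m + n * ω) = m + n * ((1 + α) / 2) := by
      rw [map_add, map_mul, map_intCast, map_intCast, this]
    refine huv.trans (Eq.trans ?_ e.symm)
    field_simp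
    linear_combination -hA' + α * hn' + hm'
  have hli2 : LinearIndependent ℤ ![(1 : 𝓞 K), ω] := by
    rw [LinearIndependent.pair_iff]
    intro s t h
    have h' : (s : K) + t * ((1 + α) / 2) = 0 := by
      have := congrArg (algebraMap (𝓞 K) K) h
      have e : (algebraMap (𝓞 K) K) ω = (1 + α) / 2 := rfl
      simpa [e] using this
    have := hli (s + t / 2) (t / 2) (by push_cast; linear_combination h')
    have ht : (t : ℚ) = 0 := by linarith [this.2]
    have hs : (s : ℚ) = 0 := by linarith [this.1]
    exact ⟨by exact_mod_cast hs, by exact_mod_cast ht⟩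
  have hspan : ⊤ ≤ Submodule.span ℤ (Set.range ![(1 : 𝓞 K), ω]) := by
    intro x _
    obtain ⟨m, n, hx⟩ := hgen x
    rw [hx, Matrix.range_cons, Matrix.range_cons, Matrix.range_empty, Set.union_empty,
      Set.singleton_union, Submodule.mem_span_pair]
    exact ⟨m, n, by simp⟩
  exact ⟨c, ω, Module.Basis.mk hli2 hspan, hc, hω, by simp [Module.Basis.mk_apply],
    by simp [Module.Basis.mk_apply]⟩


section coords
variable {R : Type*} [CommRing R] {ω : R} {b : Module.Basis (Fin 2) ℤ R}

lemma exists_coords (h0 : b 0 = 1) (h1 : b 1 = ω) (x : R) : ∃ m n : ℤ, x = m + n * ω := by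
  refine ⟨b.repr x 0, b.repr x 1, ?_⟩
  have := b.sum_repr x
  rw [Fin.sum_univ_two, h0, h1] at this
  simpa using this.symm

lemma repr_coords (h0 : b 0 = 1) (h1 : b 1 = ω) (m n : ℤ) :
    b.repr (m + n * ω) 0 = m ∧ b.repr (m + n * ω) 1 = n := by
  have : (m + n * ω : R) = m • b 0 + n • b 1 := by
    rw [h0, h1]; simp
  rw [this, map_add, map_zsmul, map_zsmul, b.repr_self, b.repr_self]
  simp

lemma coords_inj (h0 : b 0 = 1) (h1 : b 1 = ω) {m n m' n' : ℤ}
    (h : (m + n * ω : R) = m' + n' * ω) : m = m' ∧ n = n' := by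
  have a := repr_coords h0 h1 m n
  have a' := repr_coords h0 h1 m' n'
  rw [h] at a
  exact ⟨a.1.symm.trans a'.1, a.2.symm.trans a'.2⟩

lemma trace_coords (h0 : b 0 = 1) (h1 : b 1 = ω) {c : ℤ} (hω : ω ^ 2 = ω - c) (m n : ℤ) :
    Algebra.trace ℤ R (m + n * ω) = 2 * m + n := by
  have e : (m + n * ω : R) * ω = ((- (c * n) : ℤ) : R) + ((m + n : ℤ) : R) * ω := by
    push_cast; linear_combination (n : R) * hω
  rw [Algebra.trace_eq_matrix_trace b, Matrix.trace_fin_two]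
  simp only [Algebra.leftMulMatrix_eq_repr_mul, h0, h1, mul_one]
  rw [e, (repr_coords h0 h1 _ _).1, (repr_coords h0 h1 _ _).2]
  ring

end coords

lemma abs_det_empty {n : Type*} {i : Fintype n} {d : DecidableEq n} (h : IsEmpty n)
    (A : Matrix n n ℝ) : |A.det| = 1 := by
  rw [Matrix.det_isEmpty, abs_one]

section consts
variable {p : ℕ} {K : Type*} [Field K] [NumberField K] {c : ℤ} {ω : 𝓞 K}
  {b : Module.Basis (Fin 2) ℤ (𝓞 K)}

lemma discr_eq (hc : 4 * c = p + 1) (hω : ω ^ 2 = ω - c) (h0 : b 0 = 1) (h1 : b 1 = ω) :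
    NumberField.discr K = - p := by
  rw [← NumberField.discr_eq_discr K b, Algebra.discr_def, Matrix.det_fin_two]
  simp only [Algebra.traceMatrix_apply, Algebra.traceForm_apply, h0, h1]
  have t1 := trace_coords h0 h1 hω 1 0
  have t2 := trace_coords h0 h1 hω 0 1
  have t3 := trace_coords h0 h1 hω (-c) 1
  have e : ω * ω = ((-c : ℤ) : 𝓞 K) + ((1 : ℤ) : 𝓞 K) * ω := by
    push_cast; linear_combination hω
  rw [e, t3]
  simp only [Int.cast_one, Int.cast_zero, zero_mul, add_zero, zero_add, one_mul] at t1 t2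
  simp only [mul_one, one_mul, t1, t2]
  linarith

lemma torsionOrder_eq (hp3 : 3 < p) (hc : 4 * c = p + 1) (hω : ω ^ 2 = ω - c) (h0 : b 0 = 1)
    (h1 : b 1 = ω) : NumberField.Units.torsionOrder K = 2 := by
  have hunit : ∀ u : (𝓞 K)ˣ, u = 1 ∨ u = -1 := by
    intro u
    obtain ⟨m, n, hx⟩ := exists_coords h0 h1 (u : 𝓞 K)
    obtain ⟨m', n', hy⟩ := exists_coords h0 h1 ((u⁻¹ : (𝓞 K)ˣ) : 𝓞 K)
    have hxy : (u : 𝓞 K) * ((u⁻¹ : (𝓞 K)ˣ) : 𝓞 K) = 1 := by simp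
    rw [hx, hy] at hxy
    have e : ((m * m' - c * (n * n') : ℤ) : 𝓞 K) + ((m * n' + n * m' + n * n' : ℤ) : 𝓞 K) * ω =
        ((1 : ℤ) : 𝓞 K) + ((0 : ℤ) : 𝓞 K) * ω := by
      push_cast
      linear_combination hxy - (n : 𝓞 K) * n' * hω
    obtain ⟨e1, e2⟩ := coords_inj h0 h1 e
    have hN : (m ^ 2 + m * n + c * n ^ 2) * (m' ^ 2 + m' * n' + c * n' ^ 2) = 1 := by
      have : (m ^ 2 + m * n + c * n ^ 2) * (m' ^ 2 + m' * n' + c * n' ^ 2) =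
        (m * m' - c * (n * n')) ^ 2 + (m * m' - c * (n * n')) * (m * n' + n * m' + n * n') +
          c * (m * n' + n * m' + n * n') ^ 2 := by ring
      rw [this, e1, e2]; ring
    have hN1 : m ^ 2 + m * n + c * n ^ 2 = 1 := by
      rcases Int.eq_one_or_neg_one_of_mul_eq_one hN with h | h
      · exact h
      · have : 4 * (m ^ 2 + m * n + c * n ^ 2) = (2 * m + n) ^ 2 + p * n ^ 2 := by
          linear_combination n ^ 2 * hc
        nlinarith [sq_nonneg (2 * m + n), mul_nonneg (Int.natCast_nonneg p) (sq_nonneg n)]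
    have h4 : (2 * m + n) ^ 2 + p * n ^ 2 = 4 := by
      linear_combination 4 * hN1 - n ^ 2 * hc
    have hp5 : (5 : ℤ) ≤ p := by omega
    have hn : n = 0 := by
      by_contra hn
      have : 1 ≤ n ^ 2 := by have := sq_pos_of_ne_zero hn; omega
      nlinarith [sq_nonneg (2 * m + n)]
    subst hn
    have hm : m ^ 2 = 1 := by linarith
    rcases (sq_eq_sq_iff_eq_or_eq_neg.1 (hm.trans (one_pow 2).symm) : m = 1 ∨ m = -1) with h | h
    · left; ext; rw [hx, h]; simp
    · right; ext; rw [hx, h]; simp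
  rw [NumberField.Units.torsionOrder, Nat.card_eq_two_iff]
  have hne : (1 : (𝓞 K)ˣ) ≠ -1 := by
    intro h
    have := congrArg (fun u : (𝓞 K)ˣ => (u : 𝓞 K)) h
    simp only [Units.val_one, Units.val_neg] at this
    have h2 : (2 : 𝓞 K) = 0 := by linear_combination this
    exact two_ne_zero h2
  have hm : (-1 : (𝓞 K)ˣ) ∈ NumberField.Units.torsion K := by
    rw [NumberField.Units.torsion, CommGroup.mem_torsion, isOfFinOrder_iff_pow_eq_one]
    exact ⟨2, by norm_num, by simp⟩
  refine ⟨1, ⟨-1, hm⟩, fun h => hne (congrArg Subtype.val h), ?_⟩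
  ext u
  simp only [Set.mem_insert_iff, Set.mem_singleton_iff, Set.mem_univ, iff_true]
  rcases hunit u.1 with h | h
  · left; exact Subtype.ext h
  · right; exact Subtype.ext h

lemma nrReal_eq (hc : 4 * c = p + 1) (hω : ω ^ 2 = ω - c) (h3 : 3 < p) :
    NumberField.InfinitePlace.nrRealPlaces K = 0 := by
  classical
  rw [NumberField.InfinitePlace.nrRealPlaces, Fintype.card_eq_zero_iff]
  refine ⟨fun ⟨w, hw⟩ => ?_⟩
  let f : K →+* ℝ := NumberField.InfinitePlace.embedding_of_isReal hw
  let g : 𝓞 K →+* ℝ := f.comp (algebraMap (𝓞 K) K)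
  have h := congrArg g hω
  rw [map_pow, map_sub, map_intCast] at h
  have hc' : (4:ℝ) * c = p + 1 := by exact_mod_cast hc
  have : (3:ℝ) < p := by exact_mod_cast h3
  nlinarith [sq_nonneg (2 * g ω - 1)]

lemma residue_eq (hp3 : 3 < p) (hc : 4 * c = p + 1) (hω : ω ^ 2 = ω - c) (h0 : b 0 = 1)
    (h1 : b 1 = ω) (hquad : Module.finrank ℚ K = 2) :
    NumberField.dedekindZeta_residue K = π * NumberField.classNumber K / √p := by
  have hr := nrReal_eq hc hω hp3
  have hcx : NumberField.InfinitePlace.nrComplexPlaces K = 1 := by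
    have := NumberField.InfinitePlace.card_add_two_mul_card_eq_rank K
    omega
  have hrank : NumberField.Units.rank K = 0 := by
    rw [NumberField.Units.rank, NumberField.InfinitePlace.card_eq_nrRealPlaces_add_nrComplexPlaces,
      hr, hcx]
  have hreg : NumberField.Units.regulator K = 1 := by
    have hcard : Fintype.card (NumberField.InfinitePlace K) = 1 := by
      rw [NumberField.InfinitePlace.card_eq_nrRealPlaces_add_nrComplexPlaces, hr, hcx]
    obtain ⟨w', hw'⟩ := Fintype.card_eq_one_iff.1 hcard
    have : IsEmpty { w : NumberField.InfinitePlace K // w ≠ w' } := ⟨fun w => w.2 (hw' _)⟩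
    have : IsEmpty (Fin (NumberField.Units.rank K)) := by rw [hrank]; infer_instance
    rw [NumberField.Units.regulator_eq_det K w' (Equiv.equivOfIsEmpty _ _), abs_det_empty]
    infer_instance
  rw [NumberField.dedekindZeta_residue_def, hr, hcx, hreg, torsionOrder_eq hp3 hc hω h0 h1,
    discr_eq hc hω h0 h1]
  simp
  field_simp
end consts


lemma root_iff_legendre (p q : ℕ) [Fact p.Prime] [Fact q.Prime] (hp4 : p % 4 = 3) (hpq : q ≠ p)
    {c : ℤ} (hc : 4 * c = p + 1) :
    (∃ a : ℤ, (q : ℤ) ∣ a ^ 2 - a + c) ↔ legendreSym p q = 1 := by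
  have hp2 : p ≠ 2 := by rintro rfl; omega
  by_cases hq2 : q = 2
  · subst hq2
    have h1 : (∃ a : ℤ, ((2 : ℕ) : ℤ) ∣ a ^ 2 - a + c) ↔ c % 2 = 0 := by
      have key : ∀ a : ℤ, (a ^ 2 - a) % 2 = 0 := fun a => by
        have := Int.even_mul_pred_self a
        rw [Int.even_iff] at this
        rw [show a ^ 2 - a = a * (a - 1) by ring]; exact this
      constructor
      · rintro ⟨a, ha⟩
        have := key a
        push_cast at ha
        omega
      · intro h
        refine ⟨0, ?_⟩
        push_cast
        omega
    have h2 := legendreSym.at_two hp2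
    rw [h1]
    push_cast
    rw [h2, ZMod.χ₈_nat_eq_if_mod_eight]
    have : p % 8 = 3 ∨ p % 8 = 7 := by omega
    rcases this with h | h
    · simp [h, show p % 2 ≠ 0 by omega]; omega
    · simp [h, show p % 2 ≠ 0 by omega]; omega
  · have hq : q.Prime := Fact.out
    have hp : p.Prime := Fact.out
    have hqodd : q % 2 = 1 := hq.eq_two_or_odd.resolve_left hq2
    have hndvd : ((p : ℤ) : ZMod q) ≠ 0 := by
      rw [Ne, ZMod.intCast_zmod_eq_zero_iff_dvd]
      intro h
      exact hpq ((Nat.prime_dvd_prime_iff_eq hq hp).1 (by exact_mod_cast h))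
    have h1 : legendreSym q (-p) = legendreSym p q := by
      rw [show (-(p:ℤ)) = (-1) * p by ring, legendreSym.mul, legendreSym.at_neg_one hq2]
      have : q % 4 = 1 ∨ q % 4 = 3 := by omega
      rcases this with h | h
      · rw [ZMod.χ₄_nat_one_mod_four h, one_mul,
          legendreSym.quadratic_reciprocity_one_mod_four h hp2]
      · rw [ZMod.χ₄_nat_three_mod_four h,
          legendreSym.quadratic_reciprocity_three_mod_four hp4 h]
        ring
    have hne : ((-(p : ℤ) : ℤ) : ZMod q) ≠ 0 := by
      push_cast at hndvd ⊢
      exact neg_ne_zero.2 hndvd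
    rw [← h1, legendreSym.eq_one_iff q hne]
    have h2q : IsCoprime (2 : ℤ) q := by
      rw [Int.isCoprime_iff_gcd_eq_one]
      have : Nat.Coprime 2 q := (Nat.coprime_primes Nat.prime_two hq).2 (Ne.symm hq2)
      exact this
    have h4q : IsCoprime (q : ℤ) 4 := by
      have := (h2q.mul_left h2q).symm
      norm_num at this
      exact this
    constructor
    · rintro ⟨a, ha⟩
      refine ⟨((2 * a - 1 : ℤ) : ZMod q), ?_⟩
      rw [← Int.cast_mul, ZMod.intCast_eq_intCast_iff_dvd_sub]
      have := ha.mul_left 4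
      rw [show (2 * a - 1) * (2 * a - 1) - -(p : ℤ) = 4 * (a ^ 2 - a + c) by
        linear_combination -hc]
      exact this
    · rintro ⟨r, hr⟩
      obtain ⟨r, rfl⟩ := ZMod.intCast_surjective r
      rw [← Int.cast_mul, ZMod.intCast_eq_intCast_iff_dvd_sub] at hr
      obtain ⟨u, v, huv⟩ := h2q
      refine ⟨u * (r + 1), h4q.dvd_of_dvd_mul_left ?_⟩
      have e : 4 * ((u * (r + 1)) ^ 2 - u * (r + 1) + c) =
        (r * r - -p) + q * (-v * (r + 1) * (2 * u * (r + 1) - 1 + r)) := by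
        linear_combination hc + (r + 1) * (2 * u * (r + 1) - 1 + r) * huv
      rw [e]
      exact dvd_add hr (dvd_mul_right _ _)


section mult
variable {K : Type*} [Field K] [NumberField K]

lemma sup_span_of_coprime {m n : ℕ} (hmn : m.Coprime n) {I J : Ideal (𝓞 K)}
    (hI : (m : 𝓞 K) ∈ I) (hJ : (n : 𝓞 K) ∈ J) : I ⊔ J = ⊤ := by
  rw [Ideal.eq_top_iff_one]
  have h := Nat.isCoprime_iff_coprime.2 hmn
  obtain ⟨u, v, huv⟩ := h
  have : (1 : 𝓞 K) = u * m + v * n := by exact_mod_cast huv.symm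
  rw [this]
  exact Ideal.add_mem _ (Ideal.mul_mem_left _ _ (Ideal.mem_sup_left hI))
    (Ideal.mul_mem_left _ _ (Ideal.mem_sup_right hJ))

lemma left_eq_mul_sup {m n : ℕ} (hmn : m.Coprime n) {I J : Ideal (𝓞 K)}
    (hI : (m : 𝓞 K) ∈ I) (hJ : (n : 𝓞 K) ∈ J) : I = I * J ⊔ Ideal.span {(m : 𝓞 K)} := by
  apply le_antisymm
  · have h : Ideal.span {(m : 𝓞 K)} ⊔ J = ⊤ :=
      sup_span_of_coprime hmn (Ideal.mem_span_singleton_self _) hJ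
    calc I = I * (Ideal.span {(m : 𝓞 K)} ⊔ J) := by rw [h, Ideal.mul_top]
      _ = I * Ideal.span {(m : 𝓞 K)} ⊔ I * J := Ideal.mul_sup _ _ _
      _ ≤ _ := sup_le (Ideal.mul_le_right.trans le_sup_right) le_sup_left
  · exact sup_le Ideal.mul_le_left ((Ideal.span_singleton_le_iff_mem _).2 hI)

lemma card_ideals_mul (hquad : Module.finrank ℚ K = 2) {m n : ℕ} (hm : m ≠ 0)
    (hmn : m.Coprime n) :
    Nat.card {I : Ideal (𝓞 K) // Ideal.absNorm I = m * n} =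
      Nat.card {I : Ideal (𝓞 K) // Ideal.absNorm I = m} *
      Nat.card {I : Ideal (𝓞 K) // Ideal.absNorm I = n} := by
  have hfr : Module.finrank ℤ (𝓞 K) = 2 := by rw [RingOfIntegers.rank, hquad]
  rw [← Nat.card_prod]
  symm
  let f : {I : Ideal (𝓞 K) // Ideal.absNorm I = m} × {I : Ideal (𝓞 K) // Ideal.absNorm I = n} →
    {I : Ideal (𝓞 K) // Ideal.absNorm I = m * n} :=
    fun x => ⟨x.1.1 * x.2.1, by rw [map_mul, x.1.2, x.2.2]⟩
  apply Nat.card_eq_of_bijective f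
  constructor
  · rintro ⟨⟨I, hI⟩, ⟨J, hJ⟩⟩ ⟨⟨I', hI'⟩, ⟨J', hJ'⟩⟩ h
    have h : I * J = I' * J' := congrArg Subtype.val h
    have mI : (m : 𝓞 K) ∈ I := hI ▸ Ideal.absNorm_mem I
    have mI' : (m : 𝓞 K) ∈ I' := hI' ▸ Ideal.absNorm_mem I'
    have mJ : (n : 𝓞 K) ∈ J := hJ ▸ Ideal.absNorm_mem J
    have mJ' : (n : 𝓞 K) ∈ J' := hJ' ▸ Ideal.absNorm_mem J'
    have e1 : I = I' := by
      rw [left_eq_mul_sup hmn mI mJ, left_eq_mul_sup hmn mI' mJ', h]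
    have e2 : J = J' := by
      rw [left_eq_mul_sup hmn.symm mJ mI, left_eq_mul_sup hmn.symm mJ' mI', mul_comm J, h,
        mul_comm J']
    subst e1 e2
    rfl
  · rintro ⟨L, hL⟩
    have mL : (m : 𝓞 K) * n ∈ L := by
      have := Ideal.absNorm_mem L
      rw [hL] at this
      exact_mod_cast this
    set I := L ⊔ Ideal.span {(m : 𝓞 K)} with hI
    set J := L ⊔ Ideal.span {(n : 𝓞 K)} with hJ
    have mI : (m : 𝓞 K) ∈ I := Ideal.mem_sup_right (Ideal.mem_span_singleton_self _)
    have mJ : (n : 𝓞 K) ∈ J := Ideal.mem_sup_right (Ideal.mem_span_singleton_self _)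
    have hIJ : I * J = L := by
      apply le_antisymm
      · rw [hI, hJ, Ideal.sup_mul, Ideal.mul_sup, Ideal.mul_sup]
        refine sup_le (sup_le Ideal.mul_le_left Ideal.mul_le_left)
          (sup_le Ideal.mul_le_right ?_)
        rw [Ideal.span_singleton_mul_span_singleton, Ideal.span_singleton_le_iff_mem]
        exact mL
      · rw [Ideal.mul_eq_inf_of_coprime (sup_span_of_coprime hmn mI mJ)]
        exact le_inf le_sup_left le_sup_left
    have hN : Ideal.absNorm I * Ideal.absNorm J = m * n := by rw [← map_mul, hIJ, hL]
    have d1 : Ideal.absNorm I ∣ m ^ 2 := by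
      have := Ideal.absNorm_dvd_absNorm_of_le ((Ideal.span_singleton_le_iff_mem _).2 mI)
      rwa [Ideal.absNorm_span_natCast, hfr] at this
    have d2 : Ideal.absNorm J ∣ n ^ 2 := by
      have := Ideal.absNorm_dvd_absNorm_of_le ((Ideal.span_singleton_le_iff_mem _).2 mJ)
      rwa [Ideal.absNorm_span_natCast, hfr] at this
    have c1 : Nat.Coprime (Ideal.absNorm I) n := Nat.Coprime.coprime_dvd_left d1 (hmn.pow_left 2)
    have c2 : Nat.Coprime (Ideal.absNorm J) m :=
      Nat.Coprime.coprime_dvd_left d2 (hmn.symm.pow_left 2)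
    have e1 : Ideal.absNorm I ∣ m := c1.dvd_of_dvd_mul_right (hN ▸ dvd_mul_right _ _)
    have e1' : m ∣ Ideal.absNorm I :=
      c2.symm.dvd_of_dvd_mul_right (hN.symm ▸ dvd_mul_right m n)
    have E1 := Nat.dvd_antisymm e1 e1'
    have E2 : Ideal.absNorm J = n := by
      rw [E1] at hN
      exact Nat.eq_of_mul_eq_mul_left (Nat.pos_of_ne_zero hm) hN
    exact ⟨(⟨I, E1⟩, ⟨J, E2⟩), Subtype.ext hIJ⟩
end mult


section primepow
variable {K : Type*} [Field K] [NumberField K]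

/-- An ideal whose norm is a positive power of `q` is contained in a prime containing `q`. -/
lemma exists_max_of_norm {q k : ℕ} (hq : q.Prime) {I : Ideal (𝓞 K)}
    (hI : Ideal.absNorm I = q ^ (k + 1)) :
    ∃ M : Ideal (𝓞 K), M.IsPrime ∧ I ≤ M ∧ (q : 𝓞 K) ∈ M := by
  have hne : I ≠ ⊤ := by
    intro h
    rw [h, Ideal.absNorm_top] at hI
    exact (Nat.one_lt_pow (Nat.succ_ne_zero k) hq.one_lt).ne hI
  obtain ⟨M, hM, hIM⟩ := Ideal.exists_le_maximal I hne
  refine ⟨M, hM.isPrime, hIM, ?_⟩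
  have h1 := Ideal.absNorm_mem I
  rw [hI] at h1
  push_cast at h1
  exact hM.isPrime.mem_of_pow_mem _ (hIM h1)

lemma ideals_inert {q : ℕ} (hq : q.Prime) (hq2 : Ideal.absNorm (Ideal.span {(q : 𝓞 K)}) = q ^ 2)
    (hP : (Ideal.span {(q : 𝓞 K)}).IsPrime) (k : ℕ) :
    ∀ I : Ideal (𝓞 K), Ideal.absNorm I = q ^ k → Even k ∧ I = Ideal.span {(q : 𝓞 K)} ^ (k / 2) := by
  induction k using Nat.strong_induction_on with
  | _ k ih =>
    intro I hI
    rcases k with _ | k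
    · rw [pow_zero, Ideal.absNorm_eq_one_iff] at hI
      simp [hI]
    · obtain ⟨M, hM, hIM, hqM⟩ := exists_max_of_norm hq hI
      have hP0 : Ideal.span {(q : 𝓞 K)} ≠ ⊥ := by
        intro h
        rw [h, Ideal.absNorm_bot] at hq2
        exact (pow_pos hq.pos 2).ne hq2
      have hle : Ideal.span {(q : 𝓞 K)} ≤ M := (Ideal.span_singleton_le_iff_mem _).2 hqM
      have hmax : (Ideal.span {(q : 𝓞 K)}).IsMaximal := hP.isMaximal hP0
      have hPM : Ideal.span {(q : 𝓞 K)} = M := hmax.eq_of_le hM.ne_top hle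
      rw [← hPM] at hIM
      obtain ⟨J, rfl⟩ := Ideal.dvd_iff_le.2 hIM
      rw [map_mul, hq2] at hI
      rcases k with _ | k
      · exfalso
        have : q ^ 2 ∣ q ^ (0 + 1) := hI ▸ dvd_mul_right _ _
        have := (Nat.pow_dvd_pow_iff_le_right hq.one_lt).1 this
        omega
      · have hJ : Ideal.absNorm J = q ^ k := by
          rw [show q ^ (k + 1 + 1) = q ^ 2 * q ^ k by ring] at hI
          exact Nat.eq_of_mul_eq_mul_left (pow_pos hq.pos 2) hI
        obtain ⟨he, hJe⟩ := ih k (by omega) J hJ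
        refine ⟨by rw [Nat.even_iff] at he ⊢; omega, ?_⟩
        rw [show (k + 1 + 1) / 2 = k / 2 + 1 by omega, pow_succ', ← hJe]

lemma card_inert {q : ℕ} (hq : q.Prime) (hq2 : Ideal.absNorm (Ideal.span {(q : 𝓞 K)}) = q ^ 2)
    (hP : (Ideal.span {(q : 𝓞 K)}).IsPrime) (k : ℕ) :
    Nat.card {I : Ideal (𝓞 K) // Ideal.absNorm I = q ^ k} = if Even k then 1 else 0 := by
  split_ifs with h
  · rw [Nat.card_eq_one_iff_unique]
    refine ⟨⟨fun I J => Subtype.ext ?_⟩, ⟨⟨Ideal.span {(q : 𝓞 K)} ^ (k / 2), ?_⟩⟩⟩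
    · rw [(ideals_inert hq hq2 hP k I.1 I.2).2, (ideals_inert hq hq2 hP k J.1 J.2).2]
    · rw [map_pow, hq2, ← pow_mul, Nat.mul_div_cancel' h.two_dvd]
  · rw [Nat.card_eq_zero]
    left
    exact ⟨fun I => h (ideals_inert hq hq2 hP k I.1 I.2).1⟩

lemma ideals_split {q : ℕ} (hq : q.Prime) {P Q : Ideal (𝓞 K)} (hP : Ideal.absNorm P = q)
    (hQ : Ideal.absNorm Q = q) (hPQ : P * Q = Ideal.span {(q : 𝓞 K)}) (k : ℕ) :
    ∀ I : Ideal (𝓞 K), Ideal.absNorm I = q ^ k → ∃ i ≤ k, I = P ^ i * Q ^ (k - i) := by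
  have hmaxi : ∀ P : Ideal (𝓞 K), Ideal.absNorm P = q → P.IsMaximal := by
    intro P hP
    have : P.IsPrime := Ideal.isPrime_of_irreducible_absNorm (by rw [hP]; exact hq.prime.irreducible)
    refine this.isMaximal ?_
    rintro rfl
    rw [Ideal.absNorm_bot] at hP
    exact hq.pos.ne hP
  have hPm := hmaxi P hP
  have hQm := hmaxi Q hQ
  induction k with
  | zero =>
    intro I hI
    rw [pow_zero, Ideal.absNorm_eq_one_iff] at hI
    exact ⟨0, le_rfl, by simp [hI]⟩
  | succ k ih =>
    intro I hI
    obtain ⟨M, hM, hIM, hqM⟩ := exists_max_of_norm hq hI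
    have hle : P * Q ≤ M := by rw [hPQ]; exact (Ideal.span_singleton_le_iff_mem _).2 hqM
    rw [pow_succ'] at hI
    rcases hM.mul_le.1 hle with h | h
    · rw [← hPm.eq_of_le hM.ne_top h] at hIM
      obtain ⟨J, rfl⟩ := Ideal.dvd_iff_le.2 hIM
      rw [map_mul, hP] at hI
      obtain ⟨i, hi, rfl⟩ := ih J (Nat.eq_of_mul_eq_mul_left hq.pos hI)
      exact ⟨i + 1, by omega, by rw [Nat.add_sub_add_right, pow_succ', mul_assoc]⟩
    · rw [← hQm.eq_of_le hM.ne_top h] at hIM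
      obtain ⟨J, rfl⟩ := Ideal.dvd_iff_le.2 hIM
      rw [map_mul, hQ] at hI
      obtain ⟨i, hi, rfl⟩ := ih J (Nat.eq_of_mul_eq_mul_left hq.pos hI)
      exact ⟨i, by omega, by rw [Nat.succ_sub hi, pow_succ', mul_left_comm]⟩

lemma card_ramified {q : ℕ} (hq : q.Prime) {P : Ideal (𝓞 K)} (hP : Ideal.absNorm P = q)
    (hPQ : P * P = Ideal.span {(q : 𝓞 K)}) (k : ℕ) :
    Nat.card {I : Ideal (𝓞 K) // Ideal.absNorm I = q ^ k} = 1 := by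
  rw [Nat.card_eq_one_iff_unique]
  refine ⟨⟨fun I J => Subtype.ext ?_⟩, ⟨⟨P ^ k, by rw [map_pow, hP]⟩⟩⟩
  obtain ⟨i, hi, h⟩ := ideals_split hq hP hP hPQ k I.1 I.2
  obtain ⟨j, hj, h'⟩ := ideals_split hq hP hP hPQ k J.1 J.2
  rw [h, h', ← pow_add, ← pow_add, Nat.add_sub_cancel' hi, Nat.add_sub_cancel' hj]

lemma split_inj {q : ℕ} (hq : q.Prime) {P Q : Ideal (𝓞 K)} (hP : Ideal.absNorm P = q)
    (hQ : Ideal.absNorm Q = q) (hne : P ≠ Q) {k i j : ℕ} (hi : i < j) (hj : j ≤ k) :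
    P ^ i * Q ^ (k - i) ≠ P ^ j * Q ^ (k - j) := by
  intro h
  have hPp : P.IsPrime := Ideal.isPrime_of_irreducible_absNorm (by rw [hP]; exact hq.prime.irreducible)
  have hQp : Q.IsPrime := Ideal.isPrime_of_irreducible_absNorm (by rw [hQ]; exact hq.prime.irreducible)
  have hP0 : P ≠ ⊥ := by
    rintro rfl
    rw [Ideal.absNorm_bot] at hP
    exact hq.pos.ne hP
  have hQ0 : Q ≠ ⊥ := by
    rintro rfl
    rw [Ideal.absNorm_bot] at hQ
    exact hq.pos.ne hQ
  obtain ⟨d, rfl⟩ := Nat.exists_eq_add_of_lt hi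
  rw [add_assoc, pow_add, mul_assoc] at h
  have h2 := mul_left_cancel₀ (pow_ne_zero i hP0) h
  have h3 : Q ^ (k - i) ≤ P := by
    rw [h2, pow_succ', mul_assoc]
    exact Ideal.mul_le_left
  have h4 : Q ≤ P := hPp.le_of_pow_le h3
  exact hne ((hQp.isMaximal hQ0).eq_of_le hPp.ne_top h4).symm

lemma card_split {q : ℕ} (hq : q.Prime) {P Q : Ideal (𝓞 K)} (hP : Ideal.absNorm P = q)
    (hQ : Ideal.absNorm Q = q) (hPQ : P * Q = Ideal.span {(q : 𝓞 K)}) (hne : P ≠ Q) (k : ℕ) :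
    Nat.card {I : Ideal (𝓞 K) // Ideal.absNorm I = q ^ k} = k + 1 := by
  let f : Fin (k + 1) → {I : Ideal (𝓞 K) // Ideal.absNorm I = q ^ k} := fun i =>
    ⟨P ^ (i : ℕ) * Q ^ (k - i), by
      rw [map_mul, map_pow, map_pow, hP, hQ, ← pow_add, Nat.add_sub_cancel' (by omega)]⟩
  have hf : Function.Bijective f := by
    constructor
    · intro i j h
      have h : P ^ (i : ℕ) * Q ^ (k - i) = P ^ (j : ℕ) * Q ^ (k - j) := congrArg Subtype.val h
      rcases lt_trichotomy (i : ℕ) j with hij | hij | hij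
      · exact absurd h (split_inj hq hP hQ hne hij (by omega))
      · exact Fin.ext hij
      · exact absurd h.symm (split_inj hq hP hQ hne hij (by omega))
    · rintro ⟨I, hI⟩
      obtain ⟨i, hi, h⟩ := ideals_split hq hP hQ hPQ k I hI
      exact ⟨⟨i, by omega⟩, Subtype.ext h.symm⟩
  rw [← Nat.card_eq_of_bijective f hf, Nat.card_eq_fintype_card, Fintype.card_fin]
end primepow


section classify
variable {K : Type*} [Field K] [NumberField K] {c : ℤ} {ω : 𝓞 K}
  {b : Module.Basis (Fin 2) ℤ (𝓞 K)}

lemma dvd_of_int_mem {q : ℕ} (hq : q.Prime) {P : Ideal (𝓞 K)} (hP : P ≠ ⊤)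
    (hqP : (q : 𝓞 K) ∈ P) {t : ℤ} (ht : (t : 𝓞 K) ∈ P) : (q : ℤ) ∣ t := by
  by_contra h
  have hco : IsCoprime (q : ℤ) t :=
    (Nat.prime_iff_prime_int.1 hq).coprime_iff_not_dvd.2 h
  obtain ⟨u, v, huv⟩ := hco
  apply hP
  rw [Ideal.eq_top_iff_one]
  have : (1 : 𝓞 K) = u * q + v * t := by exact_mod_cast huv.symm
  rw [this]
  exact Ideal.add_mem _ (Ideal.mul_mem_left _ _ hqP) (Ideal.mul_mem_left _ _ ht)

lemma mem_span_iff_coords (h0 : b 0 = 1) (h1 : b 1 = ω) (q : ℕ) (m n : ℤ) :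
    (m + n * ω : 𝓞 K) ∈ Ideal.span {(q : 𝓞 K)} ↔ (q : ℤ) ∣ m ∧ (q : ℤ) ∣ n := by
  rw [Ideal.mem_span_singleton]
  constructor
  · rintro ⟨x, hx⟩
    obtain ⟨m', n', rfl⟩ := exists_coords h0 h1 x
    have : (m + n * ω : 𝓞 K) = ((q * m' : ℤ) : 𝓞 K) + ((q * n' : ℤ) : 𝓞 K) * ω := by
      rw [hx]; push_cast; ring
    obtain ⟨e1, e2⟩ := coords_inj h0 h1 this
    exact ⟨⟨m', e1⟩, ⟨n', e2⟩⟩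
  · rintro ⟨⟨m', rfl⟩, ⟨n', rfl⟩⟩
    exact ⟨m' + n' * ω, by push_cast; ring⟩

lemma absNorm_natCast_eq (hquad : Module.finrank ℚ K = 2) (q : ℕ) :
    Ideal.absNorm (Ideal.span {(q : 𝓞 K)}) = q ^ 2 := by
  rw [Ideal.absNorm_span_natCast, RingOfIntegers.rank, hquad]

/-- Either `(q)` is prime or a product of two ideals of norm `q`. -/
lemma prime_or_split (hquad : Module.finrank ℚ K = 2) {q : ℕ} (hq : q.Prime) :
    (Ideal.span {(q : 𝓞 K)}).IsPrime ∨ ∃ P Q : Ideal (𝓞 K), Ideal.absNorm P = q ∧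
      Ideal.absNorm Q = q ∧ P * Q = Ideal.span {(q : 𝓞 K)} := by
  have hN := absNorm_natCast_eq hquad q
  obtain ⟨P, hP, hle, -⟩ := exists_max_of_norm hq hN
  obtain ⟨J, hJ⟩ := Ideal.dvd_iff_le.2 hle
  have hNJ : Ideal.absNorm P * Ideal.absNorm J = q ^ 2 := by rw [← map_mul, ← hJ, hN]
  obtain ⟨i, hi, hPi⟩ := (Nat.dvd_prime_pow hq).1 (Dvd.intro _ hNJ)
  interval_cases i
  · exfalso
    rw [pow_zero, Ideal.absNorm_eq_one_iff] at hPi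
    exact hP.ne_top hPi
  · right
    rw [pow_one] at hPi
    refine ⟨P, J, hPi, ?_, hJ.symm⟩
    rw [hPi, pow_two] at hNJ
    exact Nat.eq_of_mul_eq_mul_left hq.pos hNJ
  · left
    rw [hPi] at hNJ
    have : Ideal.absNorm J = 1 := Nat.eq_of_mul_eq_mul_left (pow_pos hq.pos 2) (by rw [hNJ, mul_one])
    rw [Ideal.absNorm_eq_one_iff] at this
    rw [hJ, this, Ideal.mul_top]
    exact hP

lemma no_root_of_prime (h0 : b 0 = 1) (h1 : b 1 = ω) (hω : ω ^ 2 = ω - c) {q : ℕ} (hq : q.Prime)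
    (hP : (Ideal.span {(q : 𝓞 K)}).IsPrime) : ¬ ∃ a : ℤ, (q : ℤ) ∣ a ^ 2 - a + c := by
  rintro ⟨a, t, ht⟩
  have hmem : (((-a : ℤ) : 𝓞 K) + ((1 : ℤ) : 𝓞 K) * ω) * (((a - 1 : ℤ) : 𝓞 K) + ((1 : ℤ) : 𝓞 K) * ω)
      ∈ Ideal.span {(q : 𝓞 K)} := by
    rw [Ideal.mem_span_singleton]
    refine ⟨-t, ?_⟩
    have ht' : ((a : 𝓞 K) ^ 2 - a + c) = q * t := by exact_mod_cast congrArg (Int.cast : ℤ → 𝓞 K) ht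
    push_cast
    linear_combination hω - ht'
  have hn1 : ¬ (q : ℤ) ∣ 1 := by
    intro h
    exact hq.one_lt.ne' (Nat.dvd_one.1 (by exact_mod_cast h))
  rcases hP.mem_or_mem hmem with h | h
  · exact hn1 ((mem_span_iff_coords h0 h1 q _ _).1 h).2
  · exact hn1 ((mem_span_iff_coords h0 h1 q _ _).1 h).2

lemma root_of_norm (h0 : b 0 = 1) (h1 : b 1 = ω) (hquad : Module.finrank ℚ K = 2)
    {q : ℕ} (hq : q.Prime) {P : Ideal (𝓞 K)} (hP : Ideal.absNorm P = q) :
    ∃ a : ℤ, ω - a ∈ P := by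
  have hqP : (q : 𝓞 K) ∈ P := by have := Ideal.absNorm_mem P; rwa [hP] at this
  have hPt : P ≠ ⊤ := by
    rintro rfl
    rw [Ideal.absNorm_top] at hP
    exact hq.one_lt.ne hP
  have hnle : ¬ P ≤ Ideal.span {(q : 𝓞 K)} := by
    intro h
    have := Ideal.absNorm_dvd_absNorm_of_le h
    rw [absNorm_natCast_eq hquad, hP] at this
    have := Nat.le_of_dvd hq.pos this
    have := hq.one_lt
    nlinarith
  obtain ⟨x, hxP, hx⟩ := Set.not_subset.1 hnle
  obtain ⟨m, n, rfl⟩ := exists_coords h0 h1 x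
  have hx : ¬ ((q : ℤ) ∣ m ∧ (q : ℤ) ∣ n) := fun h => hx ((mem_span_iff_coords h0 h1 q m n).2 h)
  have hn : ¬ (q : ℤ) ∣ n := by
    intro hn
    refine hx ⟨dvd_of_int_mem hq hPt hqP ?_, hn⟩
    obtain ⟨t, rfl⟩ := hn
    have := P.sub_mem hxP (P.mul_mem_left (t * ω) hqP)
    push_cast at this
    convert this using 1
    ring
  have hco : IsCoprime (q : ℤ) n := (Nat.prime_iff_prime_int.1 hq).coprime_iff_not_dvd.2 hn
  obtain ⟨u, v, huv⟩ := hco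
  refine ⟨-(v * m), ?_⟩
  have huv' : (u : 𝓞 K) * q + v * n = 1 := by exact_mod_cast congrArg (Int.cast : ℤ → 𝓞 K) huv
  have := P.add_mem (P.mul_mem_left (v : 𝓞 K) hxP) (P.mul_mem_left (u * ω) hqP)
  convert this using 1
  push_cast
  linear_combination -ω * huv'

lemma root_dvd {q : ℕ} (hω : ω ^ 2 = ω - c) (hq : q.Prime) {P : Ideal (𝓞 K)}
    (hP : Ideal.absNorm P = q) {a : ℤ} (ha : ω - a ∈ P) : (q : ℤ) ∣ a ^ 2 - a + c := by
  have hqP : (q : 𝓞 K) ∈ P := by have := Ideal.absNorm_mem P; rwa [hP] at this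
  have hPt : P ≠ ⊤ := by
    rintro rfl
    rw [Ideal.absNorm_top] at hP
    exact hq.one_lt.ne hP
  apply dvd_of_int_mem hq hPt hqP
  have := P.mul_mem_left (-(ω - 1 + a)) ha
  convert this using 1
  push_cast
  linear_combination hω

lemma ramified_iff {p : ℕ} (hp : p.Prime) (hp3 : 3 < p) (hc : 4 * c = p + 1)
    (h0 : b 0 = 1) (h1 : b 1 = ω) (hω : ω ^ 2 = ω - c)
    (hquad : Module.finrank ℚ K = 2) {q : ℕ} (hq : q.Prime) {P Q : Ideal (𝓞 K)}
    (hP : Ideal.absNorm P = q) (hQ : Ideal.absNorm Q = q)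
    (hPQ : P * Q = Ideal.span {(q : 𝓞 K)}) : P = Q ↔ q = p := by
  have hqp : q ∣ p ↔ q = p := Nat.prime_dvd_prime_iff_eq hq hp
  have hPp : P.IsPrime := Ideal.isPrime_of_irreducible_absNorm (by rw [hP]; exact hq.prime.irreducible)
  have hQp : Q.IsPrime := Ideal.isPrime_of_irreducible_absNorm (by rw [hQ]; exact hq.prime.irreducible)
  constructor
  · rintro rfl
    obtain ⟨a, ha⟩ := root_of_norm h0 h1 hquad hq hP
    have h := Ideal.mul_mem_mul ha ha
    rw [hPQ] at h
    have e : (ω - a) * (ω - a) = ((a ^ 2 - c : ℤ) : 𝓞 K) + ((1 - 2 * a : ℤ) : 𝓞 K) * ω := by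
      push_cast; linear_combination hω
    rw [e, mem_span_iff_coords h0 h1] at h
    rw [← hqp]
    have h3 := root_dvd hω hq hP ha
    have : (q : ℤ) ∣ p := by
      have e2 : (p : ℤ) = 4 * (a ^ 2 - a + c) - (1 - 2 * a) * (1 - 2 * a) := by
        linear_combination -hc
      rw [e2]
      exact dvd_sub (h3.mul_left 4) (h.2.mul_left _)
    exact_mod_cast this
  · rintro rfl
    by_contra hne
    have hP0 : P ≠ ⊥ := by
      rintro rfl
      rw [Ideal.absNorm_bot] at hP
      exact hq.pos.ne hP
    have hQ0 : Q ≠ ⊥ := by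
      rintro rfl
      rw [Ideal.absNorm_bot] at hQ
      exact hq.pos.ne hQ
    have hα : ∀ P : Ideal (𝓞 K), P.IsPrime → Ideal.absNorm P = q →
        (((-1 : ℤ) : 𝓞 K) + ((2 : ℤ) : 𝓞 K) * ω) ∈ P := by
      intro P hPp hP
      have hqP : (q : 𝓞 K) ∈ P := by have := Ideal.absNorm_mem P; rwa [hP] at this
      apply hPp.mem_of_pow_mem 2
      have hc' : (4 : 𝓞 K) * c = q + 1 := by exact_mod_cast congrArg (Int.cast : ℤ → 𝓞 K) hc
      have := P.neg_mem hqP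
      convert this using 1
      push_cast
      linear_combination 4 * hω - hc'
    have hcop : P ⊔ Q = ⊤ := by
      have hPm := hPp.isMaximal hP0
      have hQm := hQp.isMaximal hQ0
      exact Ideal.IsMaximal.coprime_of_ne hPm hQm hne
    have hmem : (((-1 : ℤ) : 𝓞 K) + ((2 : ℤ) : 𝓞 K) * ω) ∈ P * Q := by
      rw [Ideal.mul_eq_inf_of_coprime hcop]
      exact ⟨hα P hPp hP, hα Q hQp hQ⟩
    rw [hPQ, mem_span_iff_coords h0 h1] at hmem
    have := Int.le_of_dvd (by norm_num) hmem.2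
    omega
end classify


section zetafactor
variable {K : Type*} [Field K] [NumberField K] {c : ℤ} {ω : 𝓞 K}
  {b : Module.Basis (Fin 2) ℤ (𝓞 K)}

/-- The number of ideals of given norm, as an arithmetic function. -/
noncomputable def idealCount (K : Type*) [Field K] [NumberField K] : ArithmeticFunction ℂ :=
  toArithmeticFunction fun n => (Nat.card {I : Ideal (𝓞 K) // Ideal.absNorm I = n} : ℂ)

lemma idealCount_apply {n : ℕ} (hn : n ≠ 0) :
    idealCount K n = (Nat.card {I : Ideal (𝓞 K) // Ideal.absNorm I = n} : ℂ) := by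
  simp [idealCount, toArithmeticFunction, hn]

lemma idealCount_mult (hquad : Module.finrank ℚ K = 2) : (idealCount K).IsMultiplicative := by
  rw [ArithmeticFunction.IsMultiplicative.iff_ne_zero]
  constructor
  · rw [idealCount_apply one_ne_zero]
    have : Nat.card {I : Ideal (𝓞 K) // Ideal.absNorm I = 1} = 1 := by
      rw [Nat.card_eq_one_iff_unique]
      refine ⟨⟨fun I J => Subtype.ext ?_⟩, ⟨⟨⊤, Ideal.absNorm_top⟩⟩⟩
      rw [Ideal.absNorm_eq_one_iff.1 I.2, Ideal.absNorm_eq_one_iff.1 J.2]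
    rw [this, Nat.cast_one]
  · intro m n hm hn hmn
    rw [idealCount_apply hm, idealCount_apply hn, idealCount_apply (mul_ne_zero hm hn),
      card_ideals_mul hquad hm hmn, Nat.cast_mul]

lemma sum_neg_one_pow (k : ℕ) :
    ∑ i ∈ Finset.range (k + 1), (-1 : ℂ) ^ i = if Even k then 1 else 0 := by
  rw [neg_one_geom_sum]
  by_cases h : Even k
  · simp [h, Nat.even_add_one]
  · simp [h, Nat.even_add_one]

lemma idealCount_eq (p : ℕ) [Fact p.Prime] (hp3 : 3 < p) (hp4 : p % 4 = 3) (hc : 4 * c = p + 1)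
    (h0 : b 0 = 1) (h1 : b 1 = ω) (hω : ω ^ 2 = ω - c) (hquad : Module.finrank ℚ K = 2) :
    idealCount K = (ArithmeticFunction.zeta : ArithmeticFunction ℂ) *
      toArithmeticFunction (fun n : ℕ => legChar p n) := by
  have hp : p.Prime := Fact.out
  rw [ArithmeticFunction.IsMultiplicative.eq_iff_eq_on_prime_powers _ (idealCount_mult hquad) _
    (ArithmeticFunction.isMultiplicative_zeta.natCast.mul
      (DirichletCharacter.isMultiplicative_toArithmeticFunction (legChar p)))]
  intro q k hq
  rw [ArithmeticFunction.coe_zeta_mul_apply, Nat.sum_divisors_prime_pow hq,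
    idealCount_apply (pow_ne_zero k hq.ne_zero)]
  have hsum : ∑ i ∈ Finset.range (k + 1), toArithmeticFunction (fun n : ℕ => legChar p n) (q ^ i) =
      ∑ i ∈ Finset.range (k + 1), (legChar p q) ^ i := by
    refine Finset.sum_congr rfl fun i _ => ?_
    rw [← DirichletCharacter.apply_eq_toArithmeticFunction_apply _ (pow_ne_zero i hq.ne_zero)]
    push_cast
    rw [map_pow]
  rw [hsum]
  have : Fact q.Prime := ⟨hq⟩
  have hleg : legChar p q = ((legendreSym p q : ℤ) : ℂ) := by
    rw [legChar_apply, legendreSym]; simp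
  have hroot := fun h : q ≠ p => root_iff_legendre p q hp4 h hc
  rcases prime_or_split hquad hq with hpr | ⟨P, Q, hP, hQ, hPQ⟩
  · have hno := no_root_of_prime h0 h1 hω hq hpr
    have hqp : q ≠ p := by
      rintro rfl
      refine hno ⟨2 * c, ?_⟩
      refine ⟨c, ?_⟩
      linear_combination c * hc
    have hl : legendreSym p q = -1 := by
      have hne : ((q : ℤ) : ZMod p) ≠ 0 := by
        rw [Ne, ZMod.intCast_zmod_eq_zero_iff_dvd]
        intro h
        exact hqp ((Nat.prime_dvd_prime_iff_eq hp hq).1 (by exact_mod_cast h)).symm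
      rcases legendreSym.eq_one_or_neg_one p hne with h | h
      · exact absurd ((hroot hqp).2 h) hno
      · exact h
    rw [card_inert hq (absNorm_natCast_eq hquad q) hpr, hleg, hl]
    push_cast
    rw [sum_neg_one_pow]
  · have hram := ramified_iff hp hp3 hc h0 h1 hω hquad hq hP hQ hPQ
    by_cases hqp : q = p
    · obtain rfl := hram.2 hqp
      have hl : legendreSym p q = 0 := by
        rw [legendreSym.eq_zero_iff, ZMod.intCast_zmod_eq_zero_iff_dvd, hqp]
      rw [card_ramified hq hP hPQ, hleg, hl]
      rw [Finset.sum_range_succ']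
      simp
    · obtain ⟨a, ha⟩ := root_of_norm h0 h1 hquad hq hP
      have hl := (hroot hqp).1 ⟨a, root_dvd hω hq hP ha⟩
      rw [card_split hq hP hQ hPQ (fun h => hqp (hram.1 h)), hleg, hl]
      simp

lemma dedekindZeta_eq (p : ℕ) [Fact p.Prime] (hp3 : 3 < p) (hp4 : p % 4 = 3) (hc : 4 * c = p + 1)
    (h0 : b 0 = 1) (h1 : b 1 = ω) (hω : ω ^ 2 = ω - c) (hquad : Module.finrank ℚ K = 2)
    {s : ℂ} (hs : 1 < s.re) :
    NumberField.dedekindZeta K s = riemannZeta s * (legChar p).LFunction s := by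
  have e1 : NumberField.dedekindZeta K s = LSeries (fun n => idealCount K n) s := by
    rw [NumberField.dedekindZeta]
    exact LSeries_congr (fun hn => (idealCount_apply hn).symm) s
  have hχ : LSeries (fun n => toArithmeticFunction (fun n : ℕ => legChar p n) n) s =
      LSeries (fun n : ℕ => legChar p n) s :=
    LSeries_congr (fun hn => (DirichletCharacter.apply_eq_toArithmeticFunction_apply _ hn).symm) s
  have hχs : LSeriesSummable (fun n => toArithmeticFunction (fun n : ℕ => legChar p n) n) s :=
    (LSeriesSummable_congr s
      (fun hn => (DirichletCharacter.apply_eq_toArithmeticFunction_apply _ hn).symm)).2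
      (DirichletCharacter.LSeriesSummable_of_one_lt_re _ hs)
  have hζ : ∀ n : ℕ, (ArithmeticFunction.zeta : ArithmeticFunction ℂ) n =
      ((ArithmeticFunction.zeta n : ℕ) : ℂ) := fun n => ArithmeticFunction.natCoe_apply
  have hz : LSeriesSummable
      (fun n => (ArithmeticFunction.zeta : ArithmeticFunction ℂ) n) s :=
    (LSeriesSummable_congr s (fun _ => hζ _)).2 (ArithmeticFunction.LSeriesSummable_zeta_iff.2 hs)
  have hz' : LSeries (fun n => (ArithmeticFunction.zeta : ArithmeticFunction ℂ) n) s =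
      riemannZeta s :=
    (LSeries_congr (fun _ => hζ _) s).trans (ArithmeticFunction.LSeries_zeta_eq_riemannZeta hs)
  have hmul := ArithmeticFunction.LSeries_mul' hz hχs
  rw [e1, idealCount_eq p hp3 hp4 hc h0 h1 hω hquad, hmul, hχ, hz',
    DirichletCharacter.LFunction_eq_LSeries _ hs]

open Filter Topology in
lemma residue_eq_L (p : ℕ) [Fact p.Prime] (hp3 : 3 < p) (hp4 : p % 4 = 3) (hc : 4 * c = p + 1)
    (h0 : b 0 = 1) (h1 : b 1 = ω) (hω : ω ^ 2 = ω - c) (hquad : Module.finrank ℚ K = 2) :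
    NumberField.dedekindZeta_residue K = π / (2 * p) * cotSum p := by
  have t1 := NumberField.tendsto_sub_one_mul_dedekindZeta_nhdsGT K
  have hof : Tendsto (fun s : ℝ => (s : ℂ)) (𝓝[>] 1) (𝓝[≠] 1) := by
    refine tendsto_nhdsWithin_iff.2 ⟨?_, ?_⟩
    · have : Tendsto (fun s : ℝ => (s : ℂ)) (𝓝 1) (𝓝 ((1 : ℝ) : ℂ)) :=
        Complex.continuous_ofReal.tendsto 1
      rw [Complex.ofReal_one] at this
      exact this.mono_left nhdsWithin_le_nhds
    · filter_upwards [self_mem_nhdsWithin] with s hs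
      simp only [Set.mem_compl_iff, Set.mem_singleton_iff]
      intro h
      have : s = 1 := by exact_mod_cast h
      exact (Set.mem_Ioi.1 hs).ne' this
  have t2 := riemannZeta_residue_one.comp hof
  have hL : Continuous (legChar p).LFunction :=
    (DirichletCharacter.differentiable_LFunction (legChar_ne_one p hp4)).continuous
  have t3 := (hL.tendsto 1).comp (hof.mono_right nhdsWithin_le_nhds)
  have t4 := t2.mul t3
  rw [one_mul, LFunction_legChar_one p hp4] at t4
  have t5 : Tendsto (fun s : ℝ => ((s : ℂ) - 1) * NumberField.dedekindZeta K s) (𝓝[>] 1)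
      (𝓝 ((π / (2 * p) * cotSum p : ℝ) : ℂ)) := by
    refine t4.congr' ?_
    filter_upwards [self_mem_nhdsWithin] with s hs
    have hs' : 1 < (s : ℂ).re := by simpa using hs
    rw [dedekindZeta_eq p hp3 hp4 hc h0 h1 hω hquad hs']
    simp only [Function.comp_apply]
    ring
  exact_mod_cast tendsto_nhds_unique t1 t5
end zetafactor

theorem classNumber_sq_eq_sum_legendre_dedekindSum
    (p : ℕ) [Fact p.Prime] (hp3 : 3 < p) (hp4 : p % 4 = 3)
    (K : Type*) [Field K] [NumberField K]
    (α : K) (hα : α ^ 2 = -(p : K)) (hquad : Module.finrank ℚ K = 2) :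
    ((NumberField.classNumber K : ℝ)) ^ 2 =
      ∑ b ∈ Finset.Ioo 0 p, (legendreSym p b : ℝ) * dedekindSum b p := by
  obtain ⟨c, ω, b, hc, hω, h0, h1⟩ := exists_integral_basis p Fact.out hp4 K α hα hquad
  have e1 := residue_eq hp3 hc hω h0 h1 hquad
  rw [residue_eq_L p hp3 hp4 hc h0 h1 hω hquad] at e1
  rw [sum_legendre_dedekind]
  have hp0 : (0 : ℝ) < p := by exact_mod_cast (by omega : 0 < p)
  have hs : √(p : ℝ) ^ 2 = p := Real.sq_sqrt hp0.le
  have hs0 : 0 < √(p : ℝ) := Real.sqrt_pos.2 hp0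
  have e2 : √(p : ℝ) * cotSum p = 2 * p * NumberField.classNumber K := by
    have hpi := Real.pi_pos
    field_simp at e1
    linarith
  have e3 : (p : ℝ) * cotSum p ^ 2 = (2 * p * NumberField.classNumber K) ^ 2 := by
    rw [← e2, mul_pow, hs]
  field_simp
  have e4 : (p : ℝ) * (cotSum p ^ 2) = p * (NumberField.classNumber K ^ 2 * 4 * p) := by
    rw [e3]; ring
  have := mul_left_cancel₀ hp0.ne' e4
  linarith
end

section
/- Let p > 3 be a prime with p ≡ 3 (mod 4). Then the class number h_K of the imaginary quadratic field K = ℚ(√−p) is odd. -/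
open NumberField

namespace ClassOdd

variable {K : Type*} [Field K] [NumberField K]

/-- Nested nonzero ideals with the same norm are equal. -/
lemma eq_of_le_of_absNorm {A B : Ideal (𝓞 K)} (hA : A ≠ ⊥) (h : A ≤ B)
    (hn : Ideal.absNorm A = Ideal.absNorm B) : A = B := by
  obtain ⟨C, rfl⟩ := Ideal.dvd_iff_le.mpr h
  rw [map_mul] at hn
  have hB : B ≠ ⊥ := by
    rintro rfl
    simp at hA
  have hB' : Ideal.absNorm B ≠ 0 := fun h0 => hB (Ideal.absNorm_eq_zero_iff.mp h0)
  have hC : Ideal.absNorm C = 1 := by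
    exact Nat.eq_of_mul_eq_mul_left (Nat.pos_of_ne_zero hB') (by rw [hn, mul_one])
  rw [Ideal.absNorm_eq_one_iff] at hC
  rw [hC, Ideal.mul_top]

lemma absNorm_map (s : 𝓞 K ≃+* 𝓞 K) (I : Ideal (𝓞 K)) :
    Ideal.absNorm (I.map s) = Ideal.absNorm I := by
  rw [Ideal.absNorm_apply, Ideal.absNorm_apply, Submodule.cardQuot_apply, Submodule.cardQuot_apply]
  exact (Nat.card_congr (Ideal.quotientEquiv I (I.map s) s rfl).toEquiv).symm

lemma map_map_conj (s : 𝓞 K ≃+* 𝓞 K) (hs : ∀ x, s (s x) = x) (I : Ideal (𝓞 K)) :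
    (I.map s).map s = I := by
  apply le_antisymm
  · rw [Ideal.map_le_iff_le_comap, Ideal.map_le_iff_le_comap]
    intro x hx
    simpa [Ideal.mem_comap, hs] using hx
  · intro x hx
    rw [← hs x]
    exact Ideal.mem_map_of_mem _ (Ideal.mem_map_of_mem _ hx)

lemma map_ne_bot (s : 𝓞 K ≃+* 𝓞 K) {I : Ideal (𝓞 K)} (hI : I ≠ ⊥) : I.map s ≠ ⊥ := by
  intro h
  apply hI
  rw [← Ideal.absNorm_eq_zero_iff] at h ⊢
  rwa [absNorm_map] at h

lemma absNorm_natCast (hquad : Module.finrank ℚ K = 2) (n : ℕ) :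
    Ideal.absNorm (Ideal.span {(n : 𝓞 K)}) = n ^ 2 := by
  rw [Ideal.absNorm_span_natCast, RingOfIntegers.rank, hquad]

/-- An ideal times its conjugate is generated by the norm. -/
lemma mul_conj (hquad : Module.finrank ℚ K = 2) (s : 𝓞 K ≃+* 𝓞 K)
    (hn : ∀ x : 𝓞 K, ((Algebra.norm ℤ x : ℤ) : 𝓞 K) = x * s x) {I : Ideal (𝓞 K)} (hI : I ≠ ⊥) :
    I * I.map s = Ideal.span {(Ideal.absNorm I : 𝓞 K)} := by
  symm
  apply eq_of_le_of_absNorm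
  · simpa [Ideal.absNorm_eq_zero_iff] using hI
  · have h := Ideal.map_relNorm ℤ I (algebraMap ℤ (𝓞 K))
    rw [Ideal.relNorm_int, Ideal.map_span, Set.image_singleton] at h
    have e : (algebraMap ℤ (𝓞 K)) (Ideal.absNorm I : ℤ) = (Ideal.absNorm I : 𝓞 K) := by simp
    rw [e] at h
    rw [h, Ideal.span_le]
    rintro _ ⟨x, hx, rfl⟩
    have : (algebraMap ℤ (𝓞 K) ∘ Algebra.intNorm ℤ (𝓞 K)) x = x * s x := by
      rw [← hn, Function.comp, Algebra.intNorm_eq_norm]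
      simp
    rw [this]
    exact Ideal.mul_mem_mul hx (Ideal.mem_map_of_mem _ hx)
  · rw [absNorm_natCast hquad, map_mul, absNorm_map, sq]

lemma prime_principal (hquad : Module.finrank ℚ K = 2) (s : 𝓞 K ≃+* 𝓞 K)
    (p : ℕ) (hp : p.Prime) (w : 𝓞 K)
    (hw : Algebra.norm ℤ (w - s w) = p)
    (P : Ideal (𝓞 K)) [P.IsMaximal] (hP : P.map s = P) :
    ∃ g, P = Ideal.span {g} := by
  obtain ⟨q, n, hn0, hqP, hq, hN⟩ := Ideal.exists_prime_and_absNorm_eq_pow P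
  have hle : Ideal.span {(q : 𝓞 K)} ≤ P := by
    rwa [Ideal.span_singleton_le_iff_mem]
  have hq0 : Ideal.span {(q : 𝓞 K)} ≠ ⊥ := by
    simpa using hq.ne_zero
  have hn2 : n ≤ 2 := by
    have := Ideal.absNorm_dvd_absNorm_of_le hle
    rw [absNorm_natCast hquad, hN] at this
    exact (Nat.pow_dvd_pow_iff_le_right hq.one_lt).mp this
  obtain rfl | rfl : n = 1 ∨ n = 2 := by omega
  · rw [pow_one] at hN
    have hcard : Nat.card (𝓞 K ⧸ P) = q := by
      rw [← hN, Ideal.absNorm_apply, Submodule.cardQuot_apply]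
    have : Fact q.Prime := ⟨hq⟩
    have h1 : (1 : 𝓞 K ⧸ P) ≠ 0 := one_ne_zero
    have hmem : w - s w ∈ P := by
      obtain ⟨k, hk⟩ := AddSubgroup.mem_zmultiples_iff.mp
        (mem_zmultiples_of_prime_card hcard h1 (g' := Ideal.Quotient.mk P w))
      have h2 : w - (k : 𝓞 K) ∈ P := by
        rw [← Ideal.Quotient.eq, ← hk]
        simp
      have h3 : s w - (k : 𝓞 K) ∈ P := by
        have := Ideal.mem_map_of_mem s h2
        rw [hP] at this
        simpa using this
      have := P.sub_mem h2 h3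
      simpa using this
    have hNw : Ideal.absNorm (Ideal.span {w - s w}) = p := by
      rw [Ideal.absNorm_span_singleton, hw]; simp
    have hle' : Ideal.span {w - s w} ≤ P := by
      rwa [Ideal.span_singleton_le_iff_mem]
    refine ⟨w - s w, (eq_of_le_of_absNorm ?_ hle' ?_).symm⟩
    · intro h
      rw [← Ideal.absNorm_eq_zero_iff, hNw] at h
      exact hp.ne_zero h
    · have := Ideal.absNorm_dvd_absNorm_of_le hle'
      rw [hNw, hN, Nat.prime_dvd_prime_iff_eq hq hp] at this
      rw [hNw, hN, this]
  · exact ⟨q, (eq_of_le_of_absNorm hq0 hle (by rw [absNorm_natCast hquad, hN])).symm⟩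

lemma stable_principal (hquad : Module.finrank ℚ K = 2) (s : 𝓞 K ≃+* 𝓞 K)
    (hs : ∀ x, s (s x) = x)
    (hn : ∀ x : 𝓞 K, ((Algebra.norm ℤ x : ℤ) : 𝓞 K) = x * s x)
    (p : ℕ) (hp : p.Prime) (w : 𝓞 K)
    (hw : Algebra.norm ℤ (w - s w) = p) (n : ℕ) :
    ∀ J : Ideal (𝓞 K), J ≠ ⊥ → J.map s = J → Ideal.absNorm J = n → ∃ g, J = Ideal.span {g} := by
  induction n using Nat.strong_induction_on with
  | _ n ih =>
  intro J hJ0 hJ hJn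
  by_cases hJt : J = ⊤
  · exact ⟨1, by rw [hJt, Ideal.span_singleton_one]⟩
  obtain ⟨P, hPm, hJP⟩ := Ideal.exists_le_maximal J hJt
  have hP0 : P ≠ ⊥ := by
    rintro rfl
    exact hJ0 (le_bot_iff.mp hJP)
  obtain ⟨A, J', hA, hAt, hAs, hJA⟩ : ∃ A J' : Ideal (𝓞 K), (∃ g, A = Ideal.span {g}) ∧ A ≠ ⊤ ∧
      A.map s = A ∧ J = A * J' := by
    by_cases hPs : P.map s = P
    · obtain ⟨J', hJ'⟩ := Ideal.dvd_iff_le.mpr hJP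
      exact ⟨P, J', prime_principal hquad s p hp w hw P hPs, hPm.ne_top, hPs, hJ'⟩
    · obtain ⟨J1, hJ1⟩ := Ideal.dvd_iff_le.mpr hJP
      have hsPm : (P.map s).IsMaximal := Ideal.map_isMaximal_of_equiv s
      have hsP : Prime (P.map s) := Ideal.prime_of_isPrime (map_ne_bot s hP0) hsPm.isPrime
      have hd : P.map s ∣ P * J1 := by
        rw [← hJ1, ← hJ]
        exact Ideal.dvd_iff_le.mpr (Ideal.map_mono hJP)
      rcases hsP.dvd_or_dvd hd with h | h
      · exact absurd (hPm.eq_of_le hsPm.ne_top (Ideal.dvd_iff_le.mp h)).symm hPs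
      · obtain ⟨J2, rfl⟩ := h
        refine ⟨P * P.map s, J2, ⟨_, mul_conj hquad s hn hP0⟩, ?_, ?_, ?_⟩
        · intro h
          exact hPm.ne_top (top_le_iff.mp (h ▸ Ideal.mul_le_left))
        · rw [Ideal.map_mul, map_map_conj s hs, mul_comm]
        · rw [hJ1, mul_assoc]
  have hA0 : A ≠ ⊥ := by
    rintro rfl
    simp at hJA
    exact hJ0 hJA
  have hJ'0 : J' ≠ ⊥ := by
    rintro rfl
    simp at hJA
    exact hJ0 hJA
  have hJ's : J'.map s = J' := by
    have h := hJ
    rw [hJA, Ideal.map_mul, hAs] at h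
    exact mul_left_cancel₀ hA0 h
  have hlt : Ideal.absNorm J' < n := by
    rw [← hJn, hJA, map_mul]
    have h1 : Ideal.absNorm A ≠ 0 := fun h => hA0 (Ideal.absNorm_eq_zero_iff.mp h)
    have h2 : Ideal.absNorm A ≠ 1 := fun h => hAt (Ideal.absNorm_eq_one_iff.mp h)
    have h3 : Ideal.absNorm J' ≠ 0 := fun h => hJ'0 (Ideal.absNorm_eq_zero_iff.mp h)
    have : 2 ≤ Ideal.absNorm A := by omega
    have h4 : 0 < Ideal.absNorm J' := Nat.pos_of_ne_zero h3
    nlinarith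
  obtain ⟨g, hg⟩ := ih _ hlt J' hJ'0 hJ's rfl
  obtain ⟨a, ha⟩ := hA
  exact ⟨a * g, by rw [hJA, ha, hg, Ideal.span_singleton_mul_span_singleton]⟩

lemma map_span (s : 𝓞 K ≃+* 𝓞 K) (x : 𝓞 K) :
    (Ideal.span {x}).map s = Ideal.span {s x} := by
  rw [Ideal.map_span, Set.image_singleton]

lemma odd_of_conj (hquad : Module.finrank ℚ K = 2) (s : 𝓞 K ≃+* 𝓞 K)
    (hs : ∀ x, s (s x) = x)
    (hn : ∀ x : 𝓞 K, ((Algebra.norm ℤ x : ℤ) : 𝓞 K) = x * s x)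
    (hpos : ∀ x : 𝓞 K, 0 ≤ Algebra.norm ℤ x)
    (p : ℕ) (hp : p.Prime) (w : 𝓞 K)
    (hw : Algebra.norm ℤ (w - s w) = p) : Odd (NumberField.classNumber K) := by
  have key := stable_principal hquad s hs hn p hp w hw
  rw [← Nat.not_even_iff_odd, even_iff_two_dvd]
  intro hdvd
  have : Fact (Nat.Prime 2) := ⟨Nat.prime_two⟩
  obtain ⟨c, hc⟩ := exists_prime_orderOf_dvd_card (G := ClassGroup (𝓞 K)) 2 hdvd
  obtain ⟨⟨I, hI⟩, rfl⟩ := ClassGroup.mk0_surjective c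
  have hI0 : I ≠ ⊥ := nonZeroDivisors.ne_zero hI
  have hne : ¬ ∃ g, I = Ideal.span {g} := by
    rintro ⟨g, hg⟩
    have : ClassGroup.mk0 ⟨I, hI⟩ = 1 := by
      rw [ClassGroup.mk0_eq_one_iff]
      exact ⟨⟨g, hg⟩⟩
    rw [this, orderOf_one] at hc
    omega
  have hsI : I.map s ∈ nonZeroDivisors (Ideal (𝓞 K)) :=
    mem_nonZeroDivisors_of_ne_zero (map_ne_bot s hI0)
  have hmul : ClassGroup.mk0 ⟨I, hI⟩ * ClassGroup.mk0 ⟨I.map s, hsI⟩ = 1 := by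
    rw [← map_mul]
    change ClassGroup.mk0 ⟨I * I.map s, _⟩ = 1
    rw [ClassGroup.mk0_eq_one_iff]
    exact ⟨⟨_, mul_conj hquad s hn hI0⟩⟩
  have hsq : ClassGroup.mk0 ⟨I, hI⟩ * ClassGroup.mk0 ⟨I, hI⟩ = 1 := by
    rw [← sq, ← hc, pow_orderOf_eq_one]
  have heq : ClassGroup.mk0 ⟨I.map s, hsI⟩ = ClassGroup.mk0 ⟨I, hI⟩ :=
    mul_left_cancel (hmul.trans hsq.symm)
  obtain ⟨a, b, ha, hb, hab⟩ := ClassGroup.mk0_eq_mk0_iff.mp heq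
  simp only at hab
  have hNI : Ideal.absNorm I ≠ 0 := fun h => hI0 (Ideal.absNorm_eq_zero_iff.mp h)
  have hN : Algebra.norm ℤ a = Algebra.norm ℤ b := by
    have h := congrArg Ideal.absNorm hab
    rw [map_mul, map_mul, absNorm_map, Ideal.absNorm_span_singleton,
      Ideal.absNorm_span_singleton] at h
    have := Nat.eq_of_mul_eq_mul_right (Nat.pos_of_ne_zero hNI) h
    have h1 := hpos a
    have h2 := hpos b
    omega
  have hNab : a * s a = b * s b := by rw [← hn, ← hn, hN]
  by_cases h0 : a + b = 0
  · apply hne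
    refine key _ I hI0 ?_ rfl
    have hba : b = -a := by linear_combination h0
    rw [hba, Ideal.span_singleton_neg] at hab
    exact mul_left_cancel₀ (by simpa using ha) hab
  · have hsa : s a ≠ 0 := by simpa using ha
    obtain ⟨d, hd⟩ : ∃ d, d = (a + b) * s a := ⟨_, rfl⟩
    have hd0 : d ≠ 0 := by
      rw [hd]
      exact mul_ne_zero h0 hsa
    have hdI : Ideal.span {d} * I ≠ ⊥ := mul_ne_zero (by simpa using hd0) hI0
    have hst : (Ideal.span {d} * I).map s = Ideal.span {d} * I := by
      rw [Ideal.map_mul, map_span]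
      apply mul_left_cancel₀ (a := Ideal.span {a}) (by simpa using ha)
      calc Ideal.span {a} * (Ideal.span {s d} * I.map s)
          = Ideal.span {s d} * (Ideal.span {a} * I.map s) := by ring
        _ = Ideal.span {s d} * (Ideal.span {b} * I) := by rw [hab]
        _ = Ideal.span {s d * b} * I := by
            rw [← mul_assoc, Ideal.span_singleton_mul_span_singleton]
        _ = Ideal.span {a * d} * I := by
            congr 3
            rw [hd, map_mul, map_add, hs]
            linear_combination (-a) * hNab
        _ = Ideal.span {a} * (Ideal.span {d} * I) := by
            rw [← mul_assoc, Ideal.span_singleton_mul_span_singleton]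
    obtain ⟨g, hg⟩ := key _ _ hdI hst rfl
    have hgd : d ∣ g := by
      rw [← Ideal.mem_span_singleton]
      have hg' : g ∈ Ideal.span {d} * I := by
        rw [hg]
        exact Ideal.mem_span_singleton_self g
      exact Ideal.mul_le_left hg'
    obtain ⟨e, rfl⟩ := hgd
    apply hne
    refine ⟨e, ?_⟩
    rw [← Ideal.span_singleton_mul_span_singleton] at hg
    exact mul_left_cancel₀ (by simpa using hd0) hg

end ClassOdd

theorem classNumber_odd (p : ℕ) [Fact p.Prime] (hp3 : 3 < p) (hp4 : p % 4 = 3)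
    (K : Type*) [Field K] [NumberField K]
    (α : K) (hα : α ^ 2 = -(p : K)) (hquad : Module.finrank ℚ K = 2) :
    Odd (NumberField.classNumber K) := by
  have hp : p.Prime := Fact.out
  have : Algebra.IsQuadraticExtension ℚ K := ⟨hquad⟩
  have : IsGalois ℚ K := inferInstance
  have hcard : Nat.card (K ≃ₐ[ℚ] K) = 2 := by rw [IsGalois.card_aut_eq_finrank, hquad]
  obtain ⟨σ, hσ1, huniv⟩ := (Nat.card_eq_two_iff' (1 : K ≃ₐ[ℚ] K)).mp hcard
  have hall : ∀ τ : K ≃ₐ[ℚ] K, τ = 1 ∨ τ = σ := by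
    intro τ
    by_cases h : τ = 1
    · exact Or.inl h
    · exact Or.inr (huniv τ h)
  have hσσ : ∀ x, σ (σ x) = x := by
    intro x
    have : σ * σ = 1 := by
      rcases hall (σ * σ) with h | h
      · exact h
      · exact absurd (mul_eq_left.mp h) hσ1
    exact congrArg (fun τ : K ≃ₐ[ℚ] K => τ x) this
  have hfix : ∀ x, σ x = x → ∃ r : ℚ, (r : K) = x := by
    intro x hx
    have := (IsGalois.mem_range_algebraMap_iff_fixed (F := ℚ) x).mpr (by
      intro τ
      rcases hall τ with rfl | rfl
      · rfl
      · exact hx)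
    obtain ⟨r, hr⟩ := this
    exact ⟨r, by simpa using hr⟩
  have hp0 : (0 : ℚ) < p := by exact_mod_cast hp.pos
  have hα0 : α ≠ 0 := by
    rintro rfl
    have : (p : K) = 0 := by simpa using hα
    exact hp.ne_zero (by exact_mod_cast this)
  have hσα : σ α = -α := by
    have h : (σ α) ^ 2 = α ^ 2 := by rw [← map_pow, hα]; simp
    rcases sq_eq_sq_iff_eq_or_eq_neg.mp h with h | h
    · obtain ⟨r, hr⟩ := hfix α h
      rw [← hr] at hα
      have : r ^ 2 = -(p : ℚ) := by exact_mod_cast hα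
      nlinarith [sq_nonneg r]
    · exact h
  have hnormK : ∀ x : K, ((Algebra.norm ℚ x : ℚ) : K) = x * σ x := by
    classical
    intro x
    have h := Algebra.norm_eq_prod_automorphisms ℚ x
    have hu : (Finset.univ : Finset (K ≃ₐ[ℚ] K)) = {1, σ} := by
      ext τ
      simpa using hall τ
    rw [hu, Finset.prod_pair (Ne.symm hσ1)] at h
    simpa using h
  have hposK : ∀ x : K, 0 ≤ Algebra.norm ℚ x := by
    intro x
    obtain ⟨t, ht⟩ := hfix (x + σ x) (by rw [map_add, hσσ, add_comm])
    obtain ⟨r, hr⟩ := hfix ((x - σ x) / α) (by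
      rw [map_div₀, map_sub, hσσ, hσα, div_neg, ← neg_div, neg_sub])
    have hr' : (r : K) * α = x - σ x := by rw [hr]; field_simp
    have h4 : ((4 * Algebra.norm ℚ x : ℚ) : K) = ((t ^ 2 + p * r ^ 2 : ℚ) : K) := by
      push_cast
      rw [hnormK, ht]
      linear_combination (r * α + x - σ x) * hr' - (r : K) ^ 2 * hα
    have h5 : 4 * Algebra.norm ℚ x = t ^ 2 + p * r ^ 2 := by exact_mod_cast h4
    have : 0 ≤ (p : ℚ) * r ^ 2 := by positivity
    nlinarith [sq_nonneg t]
  let s : 𝓞 K ≃+* 𝓞 K := RingOfIntegers.mapRingEquiv σ.toRingEquiv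
  have hsc : ∀ x : 𝓞 K, ((s x : 𝓞 K) : K) = σ (x : K) := fun x => rfl
  have hnorm : ∀ x : 𝓞 K, ((Algebra.norm ℤ x : ℤ) : ℚ) = Algebra.norm ℚ (x : K) := fun x =>
    Algebra.coe_norm_int x
  obtain ⟨m, hm⟩ : ∃ m : ℕ, p + 1 = 4 * m := ⟨(p + 1) / 4, by omega⟩
  have hmK : (p : K) + 1 = 4 * m := by exact_mod_cast hm
  have hint : IsIntegral ℤ ((1 + α) / 2) := by
    refine ⟨Polynomial.X ^ 2 - Polynomial.X + Polynomial.C (m : ℤ), ?_, ?_⟩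
    · monicity!
    · simp
      linear_combination hα / 4 - hmK / 4
  let w : 𝓞 K := ⟨(1 + α) / 2, hint⟩
  have hwα : ((w - s w : 𝓞 K) : K) = α := by
    change (1 + α) / 2 - σ ((1 + α) / 2) = α
    rw [map_div₀, map_add, hσα, map_one, map_ofNat]
    ring
  refine ClassOdd.odd_of_conj hquad s ?_ ?_ ?_ p hp w ?_
  · intro x
    apply RingOfIntegers.ext
    rw [hsc, hsc, hσσ]
  · intro x
    apply RingOfIntegers.ext
    have h : ((x * s x : 𝓞 K) : K) = (x : K) * σ (x : K) := rfl
    rw [h, ← hnormK, ← hnorm]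
    simp
  · intro x
    have := hposK x
    rw [← hnorm] at this
    exact_mod_cast this
  · have h : ((Algebra.norm ℤ (w - s w) : ℤ) : ℚ) = p := by
      rw [hnorm, hwα]
      have : ((Algebra.norm ℚ α : ℚ) : K) = ((p : ℚ) : K) := by
        rw [hnormK, hσα]
        push_cast
        linear_combination -hα
      exact_mod_cast this
    exact_mod_cast h
end

section
/- Let f > 2 be an integer and let χ be an odd primitive Dirichlet character modulo f. Then L(1,χ) = (π/(2f)) · Σ_{n=1, gcd(n,f)=1}^{f−1} χ(n) · cot(πn/f), where L(s,χ) is the Dirichlet L-function of χ. -/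
open Finset Real

lemma aux_bound {a s : ℝ} (ha : 0 < a) (ha1 : a < 1) (hs1 : 1 ≤ s) (hs2 : s ≤ 2) (n : ℕ) :
    ‖((n:ℝ) + 1 + a) ^ (-s) - ((n:ℝ) + 1 - a) ^ (-s)‖
      ≤ (4 * a / (1 - a) ^ 2) * (1 / ((n + 1 : ℕ) : ℝ) ^ 2) := by
  have hn : (0:ℝ) ≤ n := n.cast_nonneg
  set m : ℝ := (n:ℝ) + 1 with hm
  have hm1 : 1 ≤ m := by linarith
  have hx : 0 < m - a := by linarith
  have hy : 0 < m + a := by linarith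
  have h1a : 0 < 1 - a := by linarith
  set r : ℝ := (m - a) / (m + a) with hr
  have hr0 : 0 < r := by positivity
  have hr1 : r ≤ 1 := by rw [hr, div_le_one hy]; linarith
  have e1 : (m + a) ^ (-s) = (m - a) ^ (-s) * r ^ s := by
    rw [hr, Real.div_rpow hx.le hy.le, Real.rpow_neg hy.le, Real.rpow_neg hx.le]
    have := Real.rpow_pos_of_pos hx s
    field_simp
  have h2 : r ^ (2:ℝ) ≤ r ^ s := Real.rpow_le_rpow_of_exponent_ge hr0 hr1 hs2
  have h3 : r ^ s ≤ 1 := Real.rpow_le_one hr0.le hr1 (by linarith)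
  rw [Real.rpow_two] at h2
  have h4 : 1 - r ^ s ≤ 4 * a / m := by
    have : 1 - r ^ s ≤ 2 * (1 - r) := by nlinarith [sq_nonneg (1 - r)]
    have e : 2 * (1 - r) = 4 * a / (m + a) := by rw [hr]; field_simp; ring
    rw [e] at this
    refine this.trans ?_
    gcongr; linarith
  have h5 : (m - a) ^ (-s) ≤ 1 / (1 - a) ^ 2 * (1 / m) := by
    have : (1 - a) * m ≤ m - a := by nlinarith
    calc (m - a) ^ (-s) ≤ ((1 - a) * m) ^ (-s) :=
          Real.rpow_le_rpow_of_nonpos (by positivity) this (by linarith)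
      _ = (1 - a) ^ (-s) * m ^ (-s) := Real.mul_rpow h1a.le (by linarith)
      _ ≤ (1 - a) ^ (-2 : ℝ) * m ^ (-1 : ℝ) := by
          gcongr ?_ * ?_
          · exact Real.rpow_le_rpow_of_exponent_ge h1a (by linarith) (by linarith)
          · exact Real.rpow_le_rpow_of_exponent_le hm1 (by linarith)
      _ = _ := by
          rw [Real.rpow_neg h1a.le, Real.rpow_neg (by linarith), Real.rpow_two, Real.rpow_one]
          simp
  have h6 : 0 ≤ (m - a) ^ (-s) := by positivity
  rw [e1, Real.norm_eq_abs, abs_sub_comm, abs_of_nonneg (by nlinarith)]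
  have : (m - a) ^ (-s) * (1 - r ^ s) ≤ (1 / (1 - a) ^ 2 * (1 / m)) * (4 * a / m) :=
    mul_le_mul h5 h4 (by linarith) (by positivity)
  calc _ = (m - a) ^ (-s) * (1 - r ^ s) := by ring
    _ ≤ _ := this
    _ = _ := by push_cast; rw [← hm]; field_simp

lemma aux_tendsto {a : ℝ} (ha : 0 < a) (ha1 : a < 1) :
    Filter.Tendsto (fun s : ℝ => ∑' n : ℕ, (((n:ℝ) + 1 + a) ^ (-s) - ((n:ℝ) + 1 - a) ^ (-s)))
      (nhdsWithin 1 (Set.Ioi 1))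
      (nhds (∑' n : ℕ, (((n:ℝ) + 1 + a) ^ (-1:ℝ) - ((n:ℝ) + 1 - a) ^ (-1:ℝ)))) := by
  refine tendsto_tsum_of_dominated_convergence
    (bound := fun n : ℕ => (4 * a / (1 - a) ^ 2) * (1 / ((n + 1 : ℕ) : ℝ) ^ 2)) ?_ ?_ ?_
  · exact Summable.mul_left _ ((summable_nat_add_iff 1).2
      (Real.summable_one_div_nat_pow.2 one_lt_two))
  · intro n
    have hn : (0:ℝ) ≤ n := n.cast_nonneg
    have h1 : (n:ℝ) + 1 + a ≠ 0 := by linarith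
    have h2 : (n:ℝ) + 1 - a ≠ 0 := by linarith
    have : Continuous (fun s : ℝ => (((n:ℝ) + 1 + a) ^ (-s) - ((n:ℝ) + 1 - a) ^ (-s))) :=
      (Real.continuous_const_rpow h1 |>.comp continuous_neg).sub
        (Real.continuous_const_rpow h2 |>.comp continuous_neg)
    exact (this.tendsto 1).mono_left nhdsWithin_le_nhds
  · filter_upwards [Ioc_mem_nhdsGT (show (1:ℝ) < 2 by norm_num)] with s hs n
    exact aux_bound ha ha1 hs.1.le hs.2 n

lemma aux_series {a s : ℝ} (ha : 0 < a) (ha1 : a < 1) (hs : 1 < s) :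
    HurwitzZeta.hurwitzZetaOdd (a : UnitAddCircle) s =
      ((a ^ (-s) + ∑' n : ℕ, (((n:ℝ) + 1 + a) ^ (-s) - ((n:ℝ) + 1 - a) ^ (-s)) : ℝ) : ℂ) / 2 := by
  have h := (HurwitzZeta.hasSum_int_hurwitzZetaOdd a (s := (s:ℂ)) (by simpa using hs)).nat_add_neg
  rw [← hasSum_nat_add_iff' 1] at h
  have key : ∀ x : ℝ, 0 < x → (SignType.sign x : ℂ) / ((|x| : ℝ) : ℂ) ^ (s:ℂ) / 2 =
      ((x ^ (-s) : ℝ) : ℂ) / 2 := by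
    intro x hx
    rw [abs_of_pos hx, sign_pos hx, Real.rpow_neg hx.le]
    push_cast [Complex.ofReal_cpow hx.le]
    simp
  have key2 : ∀ x : ℝ, 0 < x → (SignType.sign (-x) : ℂ) / ((|-x| : ℝ) : ℂ) ^ (s:ℂ) / 2 =
      -(((x ^ (-s) : ℝ) : ℂ) / 2) := by
    intro x hx
    rw [← key x hx, Left.sign_neg, abs_neg, SignType.coe_neg, neg_div, neg_div]
  have h' := h.tsum_eq
  have e : ∀ n : ℕ, (SignType.sign ((((n + 1 : ℕ) : ℤ) : ℝ) + a) : ℂ) /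
        ((|(((n + 1 : ℕ) : ℤ) : ℝ) + a| : ℝ) : ℂ) ^ (s:ℂ) / 2 +
      (SignType.sign (((-((n + 1 : ℕ) : ℤ) : ℤ) : ℝ) + a) : ℂ) /
        ((|((-((n + 1 : ℕ) : ℤ) : ℤ) : ℝ) + a| : ℝ) : ℂ) ^ (s:ℂ) / 2 =
      ((((n:ℝ) + 1 + a) ^ (-s) - ((n:ℝ) + 1 - a) ^ (-s) : ℝ) : ℂ) / 2 := by
    intro n
    have hn : (0:ℝ) ≤ n := n.cast_nonneg
    have e1 : (((n + 1 : ℕ) : ℤ) : ℝ) + a = (n:ℝ) + 1 + a := by push_cast; ring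
    have e2 : ((-((n + 1 : ℕ) : ℤ) : ℤ) : ℝ) + a = -((n:ℝ) + 1 - a) := by push_cast; ring
    rw [e1, e2, key _ (by linarith), key2 _ (by linarith)]
    push_cast
    ring
  rw [tsum_congr e, tsum_div_const, ← Complex.ofReal_tsum] at h'
  simp only [Finset.range_one, Finset.sum_singleton, Nat.cast_zero, neg_zero, Int.cast_zero,
    zero_add, key a ha] at h'
  rw [Complex.ofReal_add, add_div, h']
  ring

lemma aux_cot {a : ℝ} (ha : 0 < a) (ha1 : a < 1) :
    HurwitzZeta.hurwitzZetaOdd (a : UnitAddCircle) 1 = π / 2 * (Real.cot (π * a) : ℂ) := by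
  have t1 : Filter.Tendsto (fun s : ℝ => HurwitzZeta.hurwitzZetaOdd (a : UnitAddCircle) s)
      (nhdsWithin 1 (Set.Ioi 1)) (nhds (HurwitzZeta.hurwitzZetaOdd (a : UnitAddCircle) 1)) := by
    have := ((HurwitzZeta.differentiable_hurwitzZetaOdd (a : UnitAddCircle)).continuous.comp
      Complex.continuous_ofReal).tendsto 1
    simp only [Function.comp_apply, Complex.ofReal_one] at this
    exact this.mono_left nhdsWithin_le_nhds
  have t2 : Filter.Tendsto (fun s : ℝ => a ^ (-s)) (nhdsWithin 1 (Set.Ioi 1))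
      (nhds (a ^ (-1:ℝ))) :=
    (((Real.continuous_const_rpow ha.ne').comp continuous_neg).tendsto 1).mono_left
      nhdsWithin_le_nhds
  have t3 := ((Complex.continuous_ofReal.tendsto _).comp
    (t2.add (aux_tendsto ha ha1))).div_const 2
  have t4 := t1.congr' (f₂ := _) (by
    filter_upwards [self_mem_nhdsWithin] with s hs
    exact aux_series ha ha1 hs)
  rw [tendsto_nhds_unique t4 t3]
  have hz : (a : ℂ) ∈ Complex.integerComplement := by
    rintro ⟨n, hn⟩
    have : (n : ℝ) = a := by exact_mod_cast hn
    rw [← this] at ha ha1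
    have h1 : 0 < n := by exact_mod_cast ha
    have h2 : n < 1 := by exact_mod_cast ha1
    omega
  have hc := cot_series_rep' hz
  have e : ∑' n : ℕ, (1 / ((a:ℂ) - (n + 1)) + 1 / (a + (n + 1))) =
      ((∑' n : ℕ, (((n:ℝ) + 1 + a) ^ (-1:ℝ) - ((n:ℝ) + 1 - a) ^ (-1:ℝ)) : ℝ) : ℂ) := by
    rw [Complex.ofReal_tsum]
    refine tsum_congr fun n => ?_
    rw [Real.rpow_neg_one, Real.rpow_neg_one]
    push_cast
    rw [← neg_sub ((n:ℂ) + 1) a, add_comm (a:ℂ), one_div, one_div, inv_neg]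
    ring
  rw [e, sub_eq_iff_eq_add] at hc
  rw [Complex.ofReal_add, ← sub_eq_iff_eq_add.2 hc, Real.rpow_neg_one]
  push_cast
  ring

theorem LFunction_one_eq_sum_char_mul_cot (f : ℕ) [NeZero f] (hf : 2 < f)
    (χ : DirichletCharacter ℂ f) (hodd : χ.Odd) (hprim : χ.IsPrimitive) :
    χ.LFunction 1 =
      ((Real.pi : ℂ) / (2 * f)) *
        ∑ n ∈ (Finset.Ioo 0 f).filter (fun n => Nat.gcd n f = 1),
          χ n * (Real.cot (Real.pi * n / f) : ℂ) := by
  have hf0 : (f : ℂ) ≠ 0 := NeZero.ne _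
  have hfR : (0 : ℝ) < f := by exact_mod_cast (by omega : 0 < f)
  have hsum : ∑ j : ZMod f, χ j * HurwitzZeta.hurwitzZetaOdd (ZMod.toAddCircle j) 1 =
      ∑ n ∈ (Finset.Ioo 0 f).filter (fun n => Nat.gcd n f = 1),
          χ n * (π / 2 * (Real.cot (Real.pi * n / f) : ℂ)) := by
    symm
    refine Finset.sum_of_injOn (fun n : ℕ => (n : ZMod f)) ?_ (by simp) ?_ ?_
    · intro x hx y hy hxy
      simp only [Finset.coe_filter, Finset.mem_Ioo, Set.mem_ofPred_eq] at hx hy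
      have := congrArg ZMod.val hxy
      simpa [ZMod.val_cast_of_lt hx.1.2, ZMod.val_cast_of_lt hy.1.2] using this
    · intro j _ hj
      have : ¬ IsUnit j := by
        intro hu
        apply hj
        refine ⟨j.val, ?_, by simp⟩
        have hc : Nat.Coprime j.val f := by
          rw [← ZMod.isUnit_iff_coprime]; simpa using hu
        have h0 : j.val ≠ 0 := by
          intro h0
          rw [h0, Nat.coprime_zero_left] at hc
          omega
        simp only [Finset.coe_filter, Finset.mem_Ioo, Set.mem_ofPred_eq]
        exact ⟨⟨Nat.pos_of_ne_zero h0, j.val_lt⟩, hc⟩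
      rw [χ.map_nonunit this, zero_mul]
    · intro n hn
      simp only [Finset.mem_filter, Finset.mem_Ioo] at hn
      have h1 : (0:ℝ) < n := by exact_mod_cast hn.1.1
      have h2 : (n:ℝ) < f := by exact_mod_cast hn.1.2
      rw [ZMod.toAddCircle_natCast, aux_cot (by positivity) (by rwa [div_lt_one hfR]),
        mul_div_assoc]
  rw [DirichletCharacter.LFunction, ZMod.LFunction_def_odd hodd.to_fun, hsum,
    Complex.cpow_neg_one, Finset.mul_sum, Finset.mul_sum]
  refine Finset.sum_congr rfl fun n _ => ?_
  field_simp
end
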